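/- arXiv:2603.17630 — 2 statements merged into one kernel-verified Lean document; each statement's English description precedes it below -/
import Mathlib

section
/- Let G be a connected graph with n vertices and minimum degree at least d (with d ≥ 2), and let d(G) denote the product of the degrees of all vertices of G. Then the number of spanning trees of G is at least d(G)·e^{-C((log d)^2/d)·n} for some absolute constant C > 0, and at most d(G)/(n-1). -/
open Function in
/-- Every orbit of a self-map of a finite type reaches a periodic point. -/
theorem exists_iterate_mem_periodicPts {V : Type*} [Finite V] (f : V → V) (v : V) :
    ∃ k, f^[k] v ∈ periodicPts f := by
  obtain ⟨i, j, hij, h⟩ := Finite.exists_ne_map_eq_of_infinite (fun k : ℕ => f^[k] v)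
  wlog hlt : i < j generalizing i j
  · exact this j i hij.symm h.symm (by omega)
  refine ⟨i, mk_mem_periodicPts (Nat.sub_pos_of_lt hlt) ?_⟩
  rw [IsPeriodicPt, IsFixedPt, ← iterate_add_apply, Nat.sub_add_cancel hlt.le, h]

open Function in
theorem exists_iterate_iterate_eq_of_mem_periodicPts {V : Type*} {f : V → V} {v : V}
    (hv : v ∈ periodicPts f) (k : ℕ) : ∃ m, f^[m] (f^[k] v) = v := by
  obtain ⟨p, hp, hpv⟩ := hv
  refine ⟨k * p - k, ?_⟩
  rw [← iterate_add_apply, Nat.sub_add_cancel (Nat.le_mul_of_pos_right k hp)]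
  exact hpv.const_mul k

/-- `R` meets every orbit of `f`, and each cycle of `f` at most once. -/
structure IsCycleTransversal {V : Type*} (f : V → V) (R : Finset V) : Prop where
  exists_iterate_mem : ∀ v, ∃ k, f^[k] v ∈ R
  iterate_eq : ∀ r ∈ R, ∀ k, f^[k] r ∈ R → f^[k] r = r

open Classical Function in
/-- The periodic points of `f` whose label is minimal along their cycle. -/
noncomputable def cycleReps {V : Type*} [Fintype V] (e : V → ℕ) (f : V → V) : Finset V :=
  {v | v ∈ periodicPts f ∧ ∀ j, e v ≤ e (f^[j] v)}

open Function in
theorem mem_cycleReps {V : Type*} [Fintype V] {e : V → ℕ} {f : V → V} {v : V} :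
    v ∈ cycleReps e f ↔ v ∈ periodicPts f ∧ ∀ j, e v ≤ e (f^[j] v) := by
  simp [cycleReps]

open Function in
theorem isCycleTransversal_cycleReps {V : Type*} [Fintype V] {e : V → ℕ} (he : Injective e)
    (f : V → V) : IsCycleTransversal f (cycleReps e f) where
  exists_iterate_mem v := by
    obtain ⟨k, hk⟩ := exists_iterate_mem_periodicPts f v
    obtain ⟨j, hj⟩ : ∃ j, ∀ i, e (f^[j] (f^[k] v)) ≤ e (f^[i] (f^[k] v)) :=
      ⟨argmin (fun j => e (f^[j] (f^[k] v))),
        fun i => argmin_le (fun j => e (f^[j] (f^[k] v))) i⟩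
    refine ⟨j + k, mem_cycleReps.2 ⟨?_, fun i => ?_⟩⟩
    · rw [iterate_add_apply]
      obtain ⟨p, hp, hpv⟩ := hk
      exact mk_mem_periodicPts hp (hpv.apply_iterate j)
    · rw [iterate_add_apply, ← iterate_add_apply f i j]
      exact hj _
  iterate_eq r hr k hk := by
    rw [mem_cycleReps] at hr hk
    obtain ⟨m, hm⟩ := exists_iterate_iterate_eq_of_mem_periodicPts hr.1 k
    refine he (le_antisymm ?_ (hr.2 k))
    simpa [hm] using hk.2 m

open Function in
/-- The number of cycles is bounded by the sum of inverse cycle lengths over all vertices. -/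
theorem card_cycleReps_le {V : Type*} [Fintype V] {e : V → ℕ} (he : Injective e)
    (f : V → V) : ((cycleReps e f).card : ℝ) ≤ ∑ v, ((minimalPeriod f v : ℝ))⁻¹ := by
  classical
  have hT := isCycleTransversal_cycleReps he f
  have hper : ∀ r ∈ cycleReps e f, r ∈ periodicPts f := fun r hr => (mem_cycleReps.1 hr).1
  set P := (cycleReps e f).sigma (fun r => Finset.range (minimalPeriod f r))
  have hinj : Set.InjOn (fun x : (_ : V) × ℕ => f^[x.2] x.1) P := by
    rintro ⟨r, i⟩ hx ⟨s, j⟩ hy hxy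
    simp only [P, Finset.coe_sigma, Set.mem_sigma_iff, Finset.mem_coe, Finset.mem_range]
      at hx hy hxy
    have hrs : r = s := by
      obtain ⟨m, hm⟩ := exists_iterate_iterate_eq_of_mem_periodicPts (hper s hy.1) j
      rw [← hxy, ← iterate_add_apply] at hm
      rw [← hT.iterate_eq r hx.1 (m + i) (by rw [hm]; exact hy.1), hm]
    subst hrs
    rw [iterate_eq_iterate_iff_of_lt_minimalPeriod hx.2 hy.2] at hxy
    rw [hxy]
  calc ((cycleReps e f).card : ℝ)
      = ∑ r ∈ cycleReps e f, ∑ j ∈ Finset.range (minimalPeriod f r),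
          ((minimalPeriod f (f^[j] r) : ℝ))⁻¹ := by
        rw [Finset.cast_card]
        refine Finset.sum_congr rfl fun r hr => ?_
        have h0 : (minimalPeriod f r : ℝ) ≠ 0 := by
          exact_mod_cast (minimalPeriod_pos_of_mem_periodicPts (hper r hr)).ne'
        simp [minimalPeriod_apply_iterate (hper r hr), h0]
    _ = ∑ x ∈ P, ((minimalPeriod f (f^[x.2] x.1) : ℝ))⁻¹ := by rw [Finset.sum_sigma]
    _ = ∑ v ∈ P.image (fun x : (_ : V) × ℕ => f^[x.2] x.1), ((minimalPeriod f v : ℝ))⁻¹ :=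
        (Finset.sum_image (f := fun v => ((minimalPeriod f v : ℝ))⁻¹) hinj).symm
    _ ≤ ∑ v, ((minimalPeriod f v : ℝ))⁻¹ :=
        Finset.sum_le_sum_of_subset_of_nonneg (Finset.subset_univ _) fun _ _ _ => by positivity

/-- The self-maps of `V` sending every vertex to one of its neighbours. -/
def neighborMaps {V : Type*} [Fintype V] [DecidableEq V] (G : SimpleGraph V)
    [DecidableRel G.Adj] : Finset (V → V) :=
  Fintype.piFinset fun v => G.neighborFinset v

theorem mem_neighborMaps {V : Type*} [Fintype V] [DecidableEq V] {G : SimpleGraph V}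
    [DecidableRel G.Adj] {f : V → V} : f ∈ neighborMaps G ↔ ∀ v, G.Adj v (f v) := by
  simp [neighborMaps]

theorem card_neighborMaps {V : Type*} [Fintype V] [DecidableEq V] (G : SimpleGraph V)
    [DecidableRel G.Adj] : (neighborMaps G).card = ∏ v, G.degree v := by
  simp [neighborMaps]

open Function in
theorem iterate_update_of_lt_minimalPeriod {V : Type*} [DecidableEq V] {f : V → V} {v : V}
    {k : ℕ} (hk : minimalPeriod f v = k + 1) (u : V) {i : ℕ} (hi : i ≤ k) :
    (update f (f^[k] v) u)^[i] v = f^[i] v := by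
  induction i with
  | zero => rfl
  | succ i ih =>
    rw [iterate_succ_apply', iterate_succ_apply', ih (by omega), update_of_ne]
    rw [Ne, iterate_eq_iterate_iff_of_lt_minimalPeriod (by omega) (by omega)]
    omega

open Function in
theorem mul_card_minimalPeriod_eq_le {V : Type*} [Fintype V] [DecidableEq V]
    (G : SimpleGraph V) [DecidableRel G.Adj] {d : ℕ} (hd : ∀ v, d ≤ G.degree v) (v : V)
    (k : ℕ) :
    d * ((neighborMaps G).filter fun f => minimalPeriod f v = k + 1).card ≤
      (neighborMaps G).card := by
  set A := (neighborMaps G).filter fun f => minimalPeriod f v = k + 1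
  calc d * A.card = ∑ f ∈ A, d := by simp [mul_comm]
    _ ≤ ∑ f ∈ A, (G.neighborFinset (f^[k] v)).card :=
        Finset.sum_le_sum fun f _ => by simpa using hd _
    _ = (A.sigma fun f => G.neighborFinset (f^[k] v)).card := (Finset.card_sigma _ _).symm
    _ ≤ (neighborMaps G).card := by
      refine Finset.card_le_card_of_injOn (fun x => update x.1 (x.1^[k] v) x.2) ?_ ?_
      · rintro ⟨f, u⟩ hx
        simp only [A, Finset.coe_sigma, Set.mem_sigma_iff, Finset.mem_coe, Finset.mem_filter,
          mem_neighborMaps, SimpleGraph.mem_neighborFinset] at hx ⊢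
        intro w
        by_cases hw : w = f^[k] v
        · subst hw; simpa using hx.2
        · simpa [hw] using hx.1.1 w
      · rintro ⟨f, u⟩ hx ⟨g, t⟩ hy hxy
        simp only [A, Finset.coe_sigma, Set.mem_sigma_iff, Finset.mem_coe,
          Finset.mem_filter] at hx hy hxy
        have hw : f^[k] v = g^[k] v := by
          rw [← iterate_update_of_lt_minimalPeriod hx.1.2 u le_rfl, hxy,
            iterate_update_of_lt_minimalPeriod hy.1.2 t le_rfl]
        have hfv : f (f^[k] v) = v := by
          rw [← iterate_succ_apply' f, Nat.succ_eq_add_one, ← hx.1.2, iterate_minimalPeriod]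
        have hgv : g (g^[k] v) = v := by
          rw [← iterate_succ_apply' g, Nat.succ_eq_add_one, ← hy.1.2, iterate_minimalPeriod]
        have hfg : f = g := by
          funext z
          by_cases hz : z = f^[k] v
          · rw [hz, hfv, hw, hgv]
          · have := congrFun hxy z
            rwa [update_of_ne hz, update_of_ne (hw ▸ hz)] at this
        subst hfg
        have := congrFun hxy (f^[k] v)
        simp only [update_self] at this
        rw [this]

theorem inv_natCast_le_add_sum_ite {d : ℕ} (hd : 0 < d) (m : ℕ) :
    (m : ℝ)⁻¹ ≤
      (d : ℝ)⁻¹ + ∑ k ∈ Finset.range d, if m = k + 1 then ((k + 1 : ℕ) : ℝ)⁻¹ else 0 := by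
  have hnn : ∀ k ∈ Finset.range d, (0 : ℝ) ≤ if m = k + 1 then ((k + 1 : ℕ) : ℝ)⁻¹ else 0 :=
    fun k _ => by split_ifs <;> positivity
  rcases Nat.eq_zero_or_pos m with rfl | hm
  · simp
  by_cases hmd : m ≤ d
  · have := Finset.single_le_sum hnn (Finset.mem_range.2 (show m - 1 < d by omega))
    rw [if_pos (by omega), Nat.sub_add_cancel hm] at this
    have : (0 : ℝ) ≤ (d : ℝ)⁻¹ := by positivity
    linarith
  · have h1 : (m : ℝ)⁻¹ ≤ (d : ℝ)⁻¹ :=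
      inv_anti₀ (by exact_mod_cast hd) (by exact_mod_cast (not_le.1 hmd).le)
    have := Finset.sum_nonneg hnn
    linarith

open Function in
theorem sum_card_cycleReps_le {V : Type*} [Fintype V] [DecidableEq V]
    (G : SimpleGraph V) [DecidableRel G.Adj] {d : ℕ} (hd0 : 0 < d)
    (hd : ∀ v, d ≤ G.degree v) {e : V → ℕ} (he : Injective e) :
    ∑ f ∈ neighborMaps G, ((cycleReps e f).card : ℝ) ≤
      (neighborMaps G).card * (Fintype.card V / d * (1 + harmonic d)) := by
  set N : ℝ := ((neighborMaps G).card : ℝ)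
  have hdR : (0 : ℝ) < d := by exact_mod_cast hd0
  have hcount : ∀ v k, ∑ f ∈ neighborMaps G,
      (if minimalPeriod f v = k + 1 then ((k + 1 : ℕ) : ℝ)⁻¹ else 0) ≤
        ((k + 1 : ℕ) : ℝ)⁻¹ * (N / d) := by
    intro v k
    rw [← Finset.sum_filter, Finset.sum_const, nsmul_eq_mul, mul_comm]
    refine mul_le_mul_of_nonneg_left ?_ (by positivity)
    rw [le_div_iff₀ hdR, mul_comm]
    simp only [N]
    exact_mod_cast mul_card_minimalPeriod_eq_le G hd v k
  calc ∑ f ∈ neighborMaps G, ((cycleReps e f).card : ℝ)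
      ≤ ∑ f ∈ neighborMaps G, ∑ v, ((d : ℝ)⁻¹ + ∑ k ∈ Finset.range d,
          if minimalPeriod f v = k + 1 then ((k + 1 : ℕ) : ℝ)⁻¹ else 0) :=
        Finset.sum_le_sum fun f _ => (card_cycleReps_le he f).trans
          (Finset.sum_le_sum fun v _ => inv_natCast_le_add_sum_ite hd0 _)
    _ = ∑ v, (N * (d : ℝ)⁻¹ + ∑ k ∈ Finset.range d, ∑ f ∈ neighborMaps G,
          if minimalPeriod f v = k + 1 then ((k + 1 : ℕ) : ℝ)⁻¹ else 0) := by
        rw [Finset.sum_comm]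
        refine Finset.sum_congr rfl fun v _ => ?_
        rw [Finset.sum_add_distrib, Finset.sum_comm]
        simp [N]
    _ ≤ ∑ _v : V, (N * (d : ℝ)⁻¹ + ∑ k ∈ Finset.range d, ((k + 1 : ℕ) : ℝ)⁻¹ * (N / d)) :=
        Finset.sum_le_sum fun v _ => add_le_add le_rfl
          (Finset.sum_le_sum fun k _ => hcount v k)
    _ = N * (Fintype.card V / d * (1 + harmonic d)) := by
        rw [← Finset.sum_mul, Finset.sum_const, Finset.card_univ, nsmul_eq_mul, harmonic]
        push_cast
        ring

/-- The graph with an edge from `v` to `f v` for every `v` outside `R`. -/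
def cutGraph {V : Type*} (f : V → V) (R : Finset V) : SimpleGraph V :=
  SimpleGraph.fromRel fun v w => v ∉ R ∧ f v = w

namespace IsCycleTransversal

variable {V : Type*} {f g : V → V} {R : Finset V}

open Classical in
/-- The number of steps needed to reach `R`. -/
noncomputable def height (h : IsCycleTransversal f R) (v : V) : ℕ :=
  Nat.find (h.exists_iterate_mem v)

theorem height_eq_add_one (h : IsCycleTransversal f R) {v : V} (hv : v ∉ R) :
    h.height v = h.height (f v) + 1 := by
  classical
  exact Nat.find_comp_succ (h.exists_iterate_mem v) (h.exists_iterate_mem (f v)) hv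

theorem apply_ne (h : IsCycleTransversal f R) {v : V} (hv : v ∉ R) : f v ≠ v := by
  intro hfv
  have := h.height_eq_add_one hv
  rw [hfv] at this
  omega

/-- Induction along the orbits of `f` up to the first point in `R`. -/
theorem induction_on (h : IsCycleTransversal f R) {p : V → Prop} (mem : ∀ r ∈ R, p r)
    (step : ∀ v, v ∉ R → p (f v) → p v) (v : V) : p v := by
  induction hn : h.height v using Nat.strong_induction_on generalizing v with
  | _ n ih =>
    by_cases hv : v ∈ R
    · exact mem v hv
    · exact step v hv (ih _ (by have := h.height_eq_add_one hv; omega) _ rfl)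

theorem cutGraph_adj_apply (h : IsCycleTransversal f R) {v : V} (hv : v ∉ R) :
    (cutGraph f R).Adj v (f v) := by
  rw [cutGraph, SimpleGraph.fromRel_adj]
  exact ⟨(h.apply_ne hv).symm, Or.inl ⟨hv, rfl⟩⟩

theorem cutGraph_isAcyclic (h : IsCycleTransversal f R) : (cutGraph f R).IsAcyclic := by
  classical
  intro v c hc
  obtain ⟨w, hw, hmax⟩ := c.support.toFinset.exists_max_image h.height ⟨v, by simp⟩
  rw [List.mem_toFinset] at hw
  have hc' := hc.rotate hw
  have key : ∀ z ∈ c.support, (cutGraph f R).Adj w z → z = f w := by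
    intro z hz hwz
    rw [cutGraph, SimpleGraph.fromRel_adj] at hwz
    rcases hwz.2 with ⟨_, h1⟩ | ⟨h1, h2⟩
    · exact h1.symm
    · have h3 := h.height_eq_add_one h1
      have h4 := hmax z (by simpa using hz)
      rw [h2] at h3
      omega
  have hsub : ∀ z ∈ (c.rotate w hw).support, z ∈ c.support :=
    fun z => (c.mem_support_rotate_iff w hw).1
  refine hc'.snd_ne_penultimate ?_
  exact (key _ (hsub _ (SimpleGraph.Walk.getVert_mem_support _ _))
      (SimpleGraph.Walk.adj_snd hc'.not_nil)).trans
    (key _ (hsub _ (SimpleGraph.Walk.getVert_mem_support _ _))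
      (SimpleGraph.Walk.adj_penultimate hc'.not_nil).symm).symm

theorem injOn_edge (h : IsCycleTransversal f R) :
    Set.InjOn (fun v => s(v, f v)) {v | v ∉ R} := by
  intro v hv w hw hvw
  rw [Sym2.eq_iff] at hvw
  rcases hvw with h1 | ⟨h1, h2⟩
  · exact h1.1
  · have h3 := h.height_eq_add_one hv
    have h4 := h.height_eq_add_one hw
    rw [h2] at h3
    rw [← h1] at h4
    omega

theorem card_le_card_edgeFinset_cutGraph_add [Fintype V] (h : IsCycleTransversal f R)
    [Fintype (cutGraph f R).edgeSet] :
    Fintype.card V ≤ (cutGraph f R).edgeFinset.card + R.card := by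
  classical
  rw [← Finset.card_compl_add_card R]
  refine Nat.add_le_add_right (Finset.card_le_card_of_injOn (fun v => s(v, f v)) ?_ ?_) _
  · intro v hv
    simpa using h.cutGraph_adj_apply (by simpa using hv)
  · exact h.injOn_edge.mono fun v hv => by simpa using hv

theorem eqOn_compl_of_cutGraph_eq (hf : IsCycleTransversal f R)
    (hfg : cutGraph f R = cutGraph g R) : ∀ v, v ∉ R → f v = g v := by
  refine hf.induction_on (fun r hr hr' => absurd hr hr') fun v hv ih _ => ?_
  by_contra hne
  have hadj := hf.cutGraph_adj_apply hv
  rw [hfg, cutGraph, SimpleGraph.fromRel_adj] at hadj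
  rcases hadj.2 with ⟨_, h1⟩ | ⟨h1, h2⟩
  · exact hne h1.symm
  · have h3 := hf.height_eq_add_one hv
    have h4 := hf.height_eq_add_one h1
    rw [ih h1, h2] at h4
    omega

/-- The first point of `R` on the orbit of `q` is the same for `f` and `g`. -/
theorem exists_common_iterate_mem (hf : IsCycleTransversal f R)
    (hfg : ∀ v, v ∉ R → f v = g v) (q : V) :
    ∃ k, f^[k] q = g^[k] q ∧ f^[k] q ∈ R := by
  refine hf.induction_on (p := fun q => ∃ k, f^[k] q = g^[k] q ∧ f^[k] q ∈ R)
    (fun r hr => ⟨0, rfl, hr⟩) (fun v hv ⟨k, h1, h2⟩ => ⟨k + 1, ?_, ?_⟩) q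
  · rw [Function.iterate_succ_apply, Function.iterate_succ_apply, ← hfg v hv, h1]
  · rwa [Function.iterate_succ_apply]

theorem eq_of_cutGraph_eq [DecidableEq V] (hf : IsCycleTransversal f R)
    (hg : IsCycleTransversal g R) (hfg : cutGraph f R = cutGraph g R)
    (himage : R.image f = R.image g) : f = g := by
  have hcompl := hf.eqOn_compl_of_cutGraph_eq hfg
  funext r
  by_cases hr : r ∈ R
  · have hmem : g r ∈ R.image f := himage ▸ Finset.mem_image_of_mem g hr
    obtain ⟨s, hs, hsr⟩ := Finset.mem_image.1 hmem
    obtain ⟨k, hk, hkR⟩ := hf.exists_common_iterate_mem hcompl (g r)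
    have h1 : f^[k] (g r) = s := by
      rw [← hsr, ← Function.iterate_succ_apply]
      refine hf.iterate_eq s hs _ ?_
      rwa [Function.iterate_succ_apply, hsr]
    have h2 : g^[k] (g r) = r := by
      rw [← Function.iterate_succ_apply]
      refine hg.iterate_eq r hr _ ?_
      rwa [Function.iterate_succ_apply, ← hk]
    rw [← h1, hk, h2] at hsr
    exact hsr
  · exact hcompl r hr

end IsCycleTransversal

theorem sum_powerset_pow_card {α : Type*} (x : ℝ) (s : Finset α) :
    ∑ t ∈ s.powerset, x ^ t.card = (1 + x) ^ s.card := by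
  simpa [add_comm] using Finset.sum_pow_mul_eq_add_pow x 1 s

/-- A map to neighbours is encoded by a spanning tree together with three small sets, which
bounds the generating function of the number of cycles. -/
theorem sum_pow_card_cycleReps_le {V : Type*} [Fintype V] [DecidableEq V]
    (G : SimpleGraph V) [DecidableRel G.Adj] (hG : G.Connected)
    {e : V → ℕ} (he : Function.Injective e)
    {x : ℝ} (hx0 : 0 ≤ x) (hx1 : x ≤ 1) :
    ∑ f ∈ neighborMaps G, x ^ (3 * (cycleReps e f).card) ≤
      ({H : SimpleGraph V | H ≤ G ∧ H.IsTree}.ncard : ℝ) * (1 + x) ^ (3 * Fintype.card V) := by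
  classical
  have hT := fun f => isCycleTransversal_cycleReps he f
  have hle : ∀ f ∈ neighborMaps G, cutGraph f (cycleReps e f) ≤ G := by
    intro f hf v w hvw
    rw [cutGraph, SimpleGraph.fromRel_adj] at hvw
    rcases hvw.2 with ⟨_, h⟩ | ⟨_, h⟩
    · exact h ▸ mem_neighborMaps.1 hf v
    · exact h ▸ (mem_neighborMaps.1 hf w).symm
  choose! T hFT hTG hTree using fun f hf =>
    hG.exists_isTree_le_of_le_of_isAcyclic (hle f hf) (hT f).cutGraph_isAcyclic
  set 𝒯 : Finset (SimpleGraph V) := {H | H ≤ G ∧ H.IsTree} with h𝒯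
  have hcard𝒯 : {H : SimpleGraph V | H ≤ G ∧ H.IsTree}.ncard = 𝒯.card := by
    rw [← Set.ncard_coe_finset, h𝒯]
    simp
  set S : (V → V) → Finset (Sym2 V) := fun f =>
    (T f).edgeFinset \ (cutGraph f (cycleReps e f)).edgeFinset with hS
  have hScard : ∀ f ∈ neighborMaps G, (S f).card ≤ (cycleReps e f).card := by
    intro f hf
    have h1 := (hTree f hf).card_edgeFinset
    have h2 := (hT f).card_le_card_edgeFinset_cutGraph_add
    have h3 := Finset.card_sdiff_add_card_eq_card
      (SimpleGraph.edgeFinset_subset_edgeFinset.2 (hFT f hf))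
    simp only [hS]
    omega
  set P := 𝒯.sigma fun H => H.edgeFinset.powerset ×ˢ
    ((Finset.univ : Finset V).powerset ×ˢ (Finset.univ : Finset V).powerset) with hP
  set φ : (V → V) → (_ : SimpleGraph V) × (Finset (Sym2 V) × (Finset V × Finset V)) :=
    fun f => ⟨T f, S f, cycleReps e f, (cycleReps e f).image f⟩ with hφ
  set w : (_ : SimpleGraph V) × (Finset (Sym2 V) × (Finset V × Finset V)) → ℝ := fun y =>
    x ^ y.2.1.card * (x ^ y.2.2.1.card * x ^ y.2.2.2.card) with hw
  have hmaps : ∀ f ∈ neighborMaps G, φ f ∈ P := by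
    intro f hf
    simp [hP, hφ, h𝒯, hTG f hf, hTree f hf, hS]
  have hinj : Set.InjOn φ (neighborMaps G) := by
    intro f hf g hg hfg
    simp only [hφ, Sigma.mk.injEq, heq_eq_eq, Prod.mk.injEq] at hfg
    obtain ⟨h1, h2, h3, h4⟩ := hfg
    have hedge : ∀ f ∈ neighborMaps G,
        (cutGraph f (cycleReps e f)).edgeFinset = (T f).edgeFinset \ S f := by
      intro f hf
      rw [hS, Finset.sdiff_sdiff_eq_self (SimpleGraph.edgeFinset_subset_edgeFinset.2 (hFT f hf))]
    have h5 : cutGraph f (cycleReps e f) = cutGraph g (cycleReps e f) := by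
      rw [← SimpleGraph.edgeFinset_inj, hedge f hf, h2, SimpleGraph.edgeFinset_inj.2 h1,
        ← hedge g hg, h3]
    have hg' := hT g
    rw [← h3] at hg' h4
    exact (hT f).eq_of_cutGraph_eq hg' h5 h4
  calc ∑ f ∈ neighborMaps G, x ^ (3 * (cycleReps e f).card)
      ≤ ∑ f ∈ neighborMaps G, w (φ f) := by
        refine Finset.sum_le_sum fun f hf => ?_
        simp only [hw, hφ]
        rw [← pow_add, ← pow_add]
        refine pow_le_pow_of_le_one hx0 hx1 ?_
        have h1 := hScard f hf
        have h2 : ((cycleReps e f).image f).card ≤ (cycleReps e f).card := Finset.card_image_le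
        omega
    _ = ∑ y ∈ (neighborMaps G).image φ, w y := (Finset.sum_image hinj).symm
    _ ≤ ∑ y ∈ P, w y :=
        Finset.sum_le_sum_of_subset_of_nonneg (Finset.image_subset_iff.2 hmaps)
          fun _ _ _ => by positivity
    _ = ∑ H ∈ 𝒯, (1 + x) ^ H.edgeFinset.card *
          ((1 + x) ^ Fintype.card V * (1 + x) ^ Fintype.card V) := by
        rw [hP, Finset.sum_sigma]
        refine Finset.sum_congr rfl fun H _ => ?_
        rw [Finset.sum_product]
        simp only [hw, Finset.sum_product, ← Finset.mul_sum, ← Finset.sum_mul,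
          sum_powerset_pow_card, Finset.card_univ]
    _ ≤ ∑ _H ∈ 𝒯, (1 + x) ^ (3 * Fintype.card V) := by
        refine Finset.sum_le_sum fun H hH => ?_
        rw [← pow_add, ← pow_add]
        refine pow_le_pow_right₀ (by linarith) ?_
        have h1 : H.IsTree := by
          rw [h𝒯, Finset.mem_filter] at hH
          exact hH.2.2
        have := h1.card_edgeFinset
        omega
    _ = _ := by rw [Finset.sum_const, nsmul_eq_mul, hcard𝒯]

theorem exp_neg_mul_card_le_sum_exp {ι : Type*} (s : Finset ι) (c : ι → ℝ) {a M : ℝ}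
    (ha : 0 ≤ a) (hM : ∑ i ∈ s, c i ≤ s.card * M) :
    s.card * Real.exp (-(a * M)) ≤ ∑ i ∈ s, Real.exp (-(a * c i)) := by
  calc s.card * Real.exp (-(a * M))
      ≤ Real.exp (-(a * M)) * (s.card + a * (s.card * M - ∑ i ∈ s, c i)) := by
        rw [mul_comm]
        refine mul_le_mul_of_nonneg_left ?_ (Real.exp_pos _).le
        have := mul_nonneg ha (sub_nonneg.2 hM)
        linarith
    _ = ∑ i ∈ s, Real.exp (-(a * M)) * (a * (M - c i) + 1) := by
        rw [← Finset.mul_sum, Finset.sum_add_distrib, ← Finset.mul_sum, Finset.sum_sub_distrib]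
        simp only [Finset.sum_const, nsmul_eq_mul, mul_one]
        ring
    _ ≤ ∑ i ∈ s, Real.exp (-(a * c i)) := by
        refine Finset.sum_le_sum fun i _ => ?_
        have h1 : Real.exp (-(a * c i)) = Real.exp (-(a * M)) * Real.exp (a * (M - c i)) := by
          rw [← Real.exp_add]
          ring_nf
        rw [h1]
        exact mul_le_mul_of_nonneg_left (Real.add_one_le_exp _) (Real.exp_pos _).le

theorem prod_degree_mul_exp_le {V : Type*} [Fintype V] [DecidableEq V] (G : SimpleGraph V)
    [DecidableRel G.Adj] {d : ℕ} (hd2 : 2 ≤ d) (hG : G.Connected)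
    (hd : ∀ v : V, d ≤ G.degree v) :
    (∏ v : V, (G.degree v : ℝ)) *
        Real.exp (-(20 * (Real.log d) ^ 2 / d) * (Fintype.card V : ℝ)) ≤
      ({H : SimpleGraph V | H ≤ G ∧ H.IsTree}.ncard : ℝ) := by
  obtain ⟨e, he⟩ : ∃ e : V → ℕ, Function.Injective e :=
    ⟨fun v => Fintype.equivFin V v, Fin.val_injective.comp (Fintype.equivFin V).injective⟩
  have hdR : (2 : ℝ) ≤ d := by exact_mod_cast hd2
  have hd0 : (0 : ℝ) < d := by linarith
  set n : ℝ := (Fintype.card V : ℝ) with hn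
  have hn0 : 0 ≤ n := Nat.cast_nonneg _
  set ℓ := Real.log d with hℓ
  have hℓ2 : 0.69 ≤ ℓ := by
    have := Real.log_two_gt_d9
    have := Real.log_le_log two_pos hdR
    linarith
  set τ : ℝ := ({H : SimpleGraph V | H ≤ G ∧ H.IsTree}.ncard : ℝ) with hτ
  set N : ℝ := ((neighborMaps G).card : ℝ) with hN
  have hprod : ∏ v : V, (G.degree v : ℝ) = N := by
    rw [hN, card_neighborMaps]
    push_cast
    rfl
  set M := n / d * (1 + harmonic d) with hM
  have hsum : N * Real.exp (-((3 * ℓ) * M)) ≤ τ * (1 + (d : ℝ)⁻¹) ^ (3 * Fintype.card V) := by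
    refine (exp_neg_mul_card_le_sum_exp (neighborMaps G) _ (by positivity)
      (sum_card_cycleReps_le G (by omega) hd he)).trans ?_
    have hx1 : (d : ℝ)⁻¹ ≤ 1 := inv_le_one_of_one_le₀ (by linarith)
    have h := sum_pow_card_cycleReps_le G hG he (x := (d : ℝ)⁻¹) (by positivity) hx1
    refine le_trans (Finset.sum_le_sum fun f _ => le_of_eq ?_) h
    rw [← Real.exp_log (inv_pos.2 hd0), ← Real.exp_nat_mul, Real.log_inv]
    congr 1
    push_cast
    ring
  have hpow : (1 + (d : ℝ)⁻¹) ^ (3 * Fintype.card V) ≤ Real.exp (3 * n / d) := by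
    calc (1 + (d : ℝ)⁻¹) ^ (3 * Fintype.card V)
        ≤ (Real.exp (d : ℝ)⁻¹) ^ (3 * Fintype.card V) := by
          gcongr
          rw [add_comm]
          exact Real.add_one_le_exp _
      _ = Real.exp (3 * n / d) := by
          rw [← Real.exp_nat_mul]
          congr 1
          push_cast
          ring
  have hexp : 3 * n / d + 3 * ℓ * M ≤ 20 * ℓ ^ 2 / d * n := by
    have hH : (harmonic d : ℝ) ≤ 1 + ℓ := harmonic_le_one_add_log d
    have h1 : 3 + 3 * ℓ * (1 + harmonic d) ≤ 20 * ℓ ^ 2 := by nlinarith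
    calc 3 * n / d + 3 * ℓ * M = (3 + 3 * ℓ * (1 + harmonic d)) * (n / d) := by
          rw [hM]; ring
      _ ≤ 20 * ℓ ^ 2 * (n / d) := mul_le_mul_of_nonneg_right h1 (by positivity)
      _ = _ := by ring
  rw [hprod]
  calc N * Real.exp (-(20 * ℓ ^ 2 / d) * n)
      ≤ N * Real.exp (-((3 * ℓ) * M) + -(3 * n / d)) :=
        mul_le_mul_of_nonneg_left (Real.exp_le_exp.2 (by linarith)) (by positivity)
    _ = N * Real.exp (-((3 * ℓ) * M)) * Real.exp (-(3 * n / d)) := by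
        rw [Real.exp_add, ← mul_assoc N]
    _ ≤ τ * Real.exp (3 * n / d) * Real.exp (-(3 * n / d)) :=
        mul_le_mul_of_nonneg_right
          (hsum.trans (mul_le_mul_of_nonneg_left hpow (by positivity))) (Real.exp_pos _).le
    _ = τ := by rw [mul_assoc, ← Real.exp_add]; simp

/-- `f` moves every vertex along an edge of `T`, traverses every edge of `T`, and `ε` is the only
edge it traverses in both directions. -/
structure IsOrientationToward {V : Type*} (T : SimpleGraph V) (ε : Sym2 V) (f : V → V) :
    Prop where
  adj_apply : ∀ v, T.Adj v (f v)
  eq_or_eq_of_adj : ∀ u v, T.Adj u v → f u = v ∨ f v = u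
  edge_eq : ∀ u, f (f u) = u → s(u, f u) = ε
  exists_apply_apply_eq : ∃ u, f (f u) = u

theorem SimpleGraph.IsTree.exists_isOrientationToward {V : Type*} {T : SimpleGraph V}
    (hT : T.IsTree) {a b : V} (hab : T.Adj a b) :
    ∃ f : V → V, IsOrientationToward T s(a, b) f := by
  classical
  have hcloser : ∀ v, v ≠ a → ∃ w, T.Adj v w ∧ T.dist v a = T.dist w a + 1 := by
    intro v hv
    obtain ⟨p, hp⟩ := hT.connected.exists_walk_length_eq_dist v a
    cases p with
    | nil => exact absurd rfl hv
    | @cons _ w _ h q =>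
      refine ⟨w, h, ?_⟩
      have h1 := SimpleGraph.dist_le q
      have h2 := hT.connected.dist_triangle (u := v) (v := w) (w := a)
      have h3 : T.dist v w = 1 := SimpleGraph.dist_eq_one_iff_adj.2 h
      rw [SimpleGraph.Walk.length_cons] at hp
      omega
  have : Nonempty V := ⟨a⟩
  choose! g hgadj hgdist using hcloser
  have huniq : ∀ u v w, T.Adj u v → T.Adj u w → T.dist u a = T.dist v a + 1 →
      T.dist u a = T.dist w a + 1 → v = w := by
    intro u v w huv huw hv hw
    obtain ⟨p, hp⟩ := hT.connected.exists_walk_length_eq_dist v a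
    obtain ⟨q, hq⟩ := hT.connected.exists_walk_length_eq_dist w a
    have hp' : (SimpleGraph.Walk.cons huv p).IsPath :=
      SimpleGraph.Walk.isPath_of_length_eq_dist _ (by simp [hp, hv])
    have hq' : (SimpleGraph.Walk.cons huw q).IsPath :=
      SimpleGraph.Walk.isPath_of_length_eq_dist _ (by simp [hq, hw])
    have := (hT.existsUnique_path u a).unique hp' hq'
    simpa using congrArg SimpleGraph.Walk.snd this
  have hgeq : ∀ u v, T.Adj u v → T.dist a u = T.dist a v + 1 →
      Function.update g a b u = v := by
    intro u v huv h
    rw [SimpleGraph.dist_comm, T.dist_comm (u := a)] at h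
    have hu : u ≠ a := by
      rintro rfl
      simp at h
    rw [Function.update_of_ne hu]
    exact huniq u _ _ (hgadj u hu) huv (hgdist u hu) h
  have hgb : g b = a := by
    have h1 := hgdist b hab.ne'
    have h2 : T.dist b a = 1 := SimpleGraph.dist_eq_one_iff_adj.2 hab.symm
    exact hT.connected.dist_eq_zero_iff.1 (by omega)
  refine ⟨Function.update g a b, fun v => ?_, fun u v huv => ?_, fun u hu => ?_,
    a, by simp [hab.ne', hgb]⟩
  · by_cases hv : v = a
    · subst hv; simpa using hab
    · simpa [hv] using hgadj v hv
  · rcases hT.dist_eq_dist_add_one_of_adj a huv with h | h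
    · exact Or.inl (hgeq u v huv h)
    · exact Or.inr (hgeq v u huv.symm h)
  · by_cases hua : u = a
    · subst hua
      simp
    rw [Function.update_of_ne hua] at hu ⊢
    by_cases hga : g u = a
    · rw [hga, Function.update_self] at hu
      rw [hga, hu, Sym2.eq_swap]
    · rw [Function.update_of_ne hga] at hu
      have h1 := hgdist u hua
      have h2 := hgdist _ hga
      rw [hu] at h2
      omega

theorem IsOrientationToward.le {V : Type*} {T K : SimpleGraph V} {ε δ : Sym2 V} {f : V → V}
    (h : IsOrientationToward T ε f) (hK : IsOrientationToward K δ f) : T ≤ K := by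
  intro u v huv
  rcases h.eq_or_eq_of_adj u v huv with h1 | h1
  · exact h1 ▸ hK.adj_apply u
  · exact h1 ▸ (hK.adj_apply v).symm

theorem mul_ncard_isTree_le {V : Type*} [Fintype V] [DecidableEq V] (G : SimpleGraph V)
    [DecidableRel G.Adj] :
    {H : SimpleGraph V | H ≤ G ∧ H.IsTree}.ncard * (Fintype.card V - 1) ≤
      ∏ v : V, G.degree v := by
  classical
  rw [← card_neighborMaps]
  have horient : ∀ (H : SimpleGraph V) (ε : Sym2 V), H.IsTree → ε ∈ H.edgeSet →
      ∃ f : V → V, IsOrientationToward H ε f := by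
    intro H ε hH
    induction ε with
    | _ a b => exact fun hab => hH.exists_isOrientationToward hab
  have : Nonempty (V → V) := ⟨id⟩
  choose! F hF using horient
  set 𝒯 : Finset (SimpleGraph V) := {H | H ≤ G ∧ H.IsTree} with h𝒯
  have hcard𝒯 : {H : SimpleGraph V | H ≤ G ∧ H.IsTree}.ncard = 𝒯.card := by
    rw [← Set.ncard_coe_finset, h𝒯]
    simp
  have hcardP : (𝒯.sigma fun H => H.edgeFinset).card = 𝒯.card * (Fintype.card V - 1) := by
    rw [Finset.card_sigma]
    refine Finset.sum_const_nat fun H hH => ?_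
    have h1 : H.IsTree := (Finset.mem_filter.1 hH).2.2
    have := h1.card_edgeFinset
    omega
  rw [hcard𝒯, ← hcardP]
  refine Finset.card_le_card_of_injOn (fun x => F x.1 x.2) ?_ ?_
  · rintro ⟨H, ε⟩ hx
    simp only [h𝒯, Finset.coe_sigma, Set.mem_sigma_iff, Finset.mem_coe, Finset.mem_filter,
      Finset.mem_univ, true_and, SimpleGraph.mem_edgeFinset] at hx
    exact mem_neighborMaps.2 fun v => hx.1.1 ((hF H ε hx.1.2 hx.2).adj_apply v)
  · rintro ⟨H, ε⟩ hx ⟨K, δ⟩ hy hxy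
    simp only [h𝒯, Finset.coe_sigma, Set.mem_sigma_iff, Finset.mem_coe, Finset.mem_filter,
      Finset.mem_univ, true_and, SimpleGraph.mem_edgeFinset] at hx hy hxy
    have hH := hF H ε hx.1.2 hx.2
    have hK := hF K δ hy.1.2 hy.2
    rw [← hxy] at hK
    have hHK : H = K := le_antisymm (hH.le hK) (hK.le hH)
    subst hHK
    obtain ⟨u, hu⟩ := hH.exists_apply_apply_eq
    rw [← hH.edge_eq u hu, ← hK.edge_eq u hu]

/-- **Kostochka's theorem.** Let `G` be a connected graph with `n` vertices and minimum
degree at least `d` (with `d ≥ 2`), and let `d(G) = ∏_v d_G(v)`. Then the number of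
spanning trees of `G` is at least `d(G) · e^{-C((log d)^2/d)·n}` for some absolute
constant `C > 0`, and at most `d(G)/(n-1)`. -/
theorem kostochka_spanning_tree_count :
    ∃ C : ℝ, 0 < C ∧
      ∀ (V : Type) [Fintype V] [DecidableEq V] (G : SimpleGraph V) [DecidableRel G.Adj]
        (d : ℕ), 2 ≤ d → G.Connected → (∀ v : V, d ≤ G.degree v) →
        (∏ v : V, (G.degree v : ℝ)) *
            Real.exp (-(C * (Real.log d) ^ 2 / d) * (Fintype.card V : ℝ)) ≤
          ({H : SimpleGraph V | H ≤ G ∧ H.IsTree}.ncard : ℝ) ∧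
        ({H : SimpleGraph V | H ≤ G ∧ H.IsTree}.ncard : ℝ) ≤
          (∏ v : V, (G.degree v : ℝ)) / ((Fintype.card V : ℝ) - 1) := by
  refine ⟨20, by norm_num, fun V _ _ G _ d hd2 hG hd =>
    ⟨prod_degree_mul_exp_le G hd2 hG hd, ?_⟩⟩
  obtain ⟨v⟩ := hG.nonempty
  have hcard : 1 < Fintype.card V := by
    have := G.degree_lt_card_verts v
    have := hd v
    omega
  have hcardR : (1 : ℝ) < Fintype.card V := by exact_mod_cast hcard
  rw [le_div_iff₀ (by linarith)]
  have h : (({H : SimpleGraph V | H ≤ G ∧ H.IsTree}.ncard * (Fintype.card V - 1) : ℕ) : ℝ) ≤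
      ((∏ v : V, G.degree v : ℕ) : ℝ) := by exact_mod_cast mul_ncard_isTree_le G
  rw [Nat.cast_mul, Nat.cast_sub hcard.le] at h
  simpa using h
end

section
/- There exist constants δ > 0, c > 0 and d_0 such that for all d ≥ d_0, if G is a connected graph with n vertices all of whose degrees lie in the interval [(1-δ)d, (1+δ)d], then the number of pairwise non-isomorphic spanning trees of G is at least e^{c·n}. -/
section SpanningTreeCount
open Finset
open scoped Classical

variable {V : Type*} [Fintype V]

lemma SimpleGraph.exists_almost_dominating (G : SimpleGraph V) (k : ℕ) (hk : 0 < k)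
    (hdeg : ∀ v, k * k ≤ 2 * G.degree v) :
    ∃ D : Finset V, (∀ v ∉ D, ∃ u ∈ D, G.Adj v u) ∧ k * #D ≤ 3 * Fintype.card V := by
  let X : Finset V → Finset V := fun D => univ.filter fun v => ∀ u ∈ D, ¬ G.Adj v u
  obtain ⟨D, hD⟩ := Finite.exists_min (fun D : Finset V => k * #D + #(X D))
  have h0 : k * #D + #(X D) ≤ Fintype.card V := by
    refine (hD ∅).trans ?_
    simpa using card_le_univ (X ∅)
  have h1 : ∀ v, #(G.neighborFinset v ∩ X D) ≤ k := by
    intro v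
    have h2 := hD (insert v D)
    have h3 : X (insert v D) ⊆ X D \ (G.neighborFinset v ∩ X D) := by
      intro x hx
      simp only [X, mem_filter, mem_univ, true_and, mem_insert, forall_eq_or_imp, mem_sdiff,
        mem_inter, SimpleGraph.mem_neighborFinset, not_and] at hx ⊢
      exact ⟨hx.2, fun h => absurd h.symm hx.1⟩
    have h4 := card_le_card h3
    rw [card_sdiff_of_subset inter_subset_right] at h4
    have h5 : #(insert v D) ≤ #D + 1 := card_insert_le _ _
    have h6 : #(G.neighborFinset v ∩ X D) ≤ #(X D) := card_le_card inter_subset_right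
    have h7 : k * #(insert v D) ≤ k * (#D + 1) := Nat.mul_le_mul_left _ h5
    rw [mul_add] at h7
    omega
  have h2 : ∑ v, #(G.neighborFinset v ∩ X D) = ∑ x ∈ X D, G.degree x := by
    have : ∀ v, #(G.neighborFinset v ∩ X D) = ∑ x ∈ X D, if G.Adj x v then 1 else 0 := by
      intro v
      rw [← card_filter]
      congr 1
      ext x
      simp [and_comm, G.adj_comm]
    simp_rw [this]
    rw [sum_comm]
    refine sum_congr rfl fun x _ => ?_
    rw [← card_filter, ← SimpleGraph.card_neighborFinset_eq_degree]
    congr 1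
    ext v
    simp
  have h3 : ∑ v, #(G.neighborFinset v ∩ X D) ≤ Fintype.card V * k := by
    simpa using sum_le_card_nsmul univ _ k fun v _ => h1 v
  have h4 : #(X D) * (k * k) ≤ 2 * ∑ x ∈ X D, G.degree x := by
    rw [mul_sum]
    simpa using card_nsmul_le_sum (X D) _ (k * k) fun v _ => hdeg v
  have h5 : k * #(X D) ≤ 2 * Fintype.card V := by
    refine Nat.le_of_mul_le_mul_right ?_ hk
    nlinarith
  refine ⟨D ∪ X D, fun v hv => ?_, ?_⟩
  · simp only [X, mem_union, mem_filter, mem_univ, true_and, not_or, not_forall, not_not] at hv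
    obtain ⟨u, hu, h⟩ := hv.2
    exact ⟨u, mem_union_left _ hu, h⟩
  · have := card_union_le D (X D)
    nlinarith

/-- `q 0, …, q (K - 1)` is a path of `G` on `K` vertices of `S`. -/
def SimpleGraph.IsPathIn (G : SimpleGraph V) (S : Set V) (K : ℕ) (q : ℕ → V) : Prop :=
  Set.InjOn q (Set.Iio K) ∧ (∀ i < K, q i ∈ S) ∧ ∀ i, i + 1 < K → G.Adj (q i) (q (i + 1))

lemma SimpleGraph.exists_isPathIn_of_degree (G : SimpleGraph V) (S : Finset V) (hS : S.Nonempty)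
    (K : ℕ)
    (h : ∀ v ∈ S, K ≤ #(G.neighborFinset v ∩ S)) : ∃ q, G.IsPathIn S K q := by
  suffices ∀ j ≤ K, ∃ q, G.IsPathIn (S : Set V) j q from this K le_rfl
  intro j hj
  induction j with
  | zero => exact ⟨fun _ => hS.choose, by simp [IsPathIn]⟩
  | succ j ih =>
    obtain ⟨q, hq, hqS, hqA⟩ := ih (by omega)
    obtain ⟨w, hwS, hw, hwA⟩ : ∃ w ∈ S, w ∉ (range j).image q ∧
        ∀ i, i + 1 = j → G.Adj (q i) w := by
      rcases Nat.eq_zero_or_pos j with rfl | hj0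
      · exact ⟨hS.choose, hS.choose_spec, by simp, by simp⟩
      · have h1 : #((range j).image q) < #(G.neighborFinset (q (j - 1)) ∩ S) :=
          card_image_le.trans_lt ((by simpa using hj : #(range j) < K).trans_le
            (h _ (hqS _ (by omega))))
        obtain ⟨w, hw, hw'⟩ := exists_mem_notMem_of_card_lt_card h1
        simp only [mem_inter, mem_neighborFinset] at hw
        refine ⟨w, hw.2, hw', fun i hi => ?_⟩
        obtain rfl : i = j - 1 := by omega
        exact hw.1
    have hw' : ∀ i < j, q i ≠ w := fun i hi e => hw (mem_image.2 ⟨i, by simpa using hi, e⟩)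
    refine ⟨Function.update q j w, ?_, ?_, ?_⟩
    · intro a ha b hb hab
      simp only [Set.mem_Iio] at ha hb
      rcases Nat.lt_succ_iff_lt_or_eq.1 ha with ha | rfl <;>
        rcases Nat.lt_succ_iff_lt_or_eq.1 hb with hb | rfl
      · rw [Function.update_of_ne ha.ne, Function.update_of_ne hb.ne] at hab
        exact hq ha hb hab
      · rw [Function.update_of_ne ha.ne, Function.update_self] at hab
        exact absurd hab (hw' _ ha)
      · rw [Function.update_of_ne hb.ne, Function.update_self] at hab
        exact absurd hab.symm (hw' _ hb)
      · rfl
    · intro i hi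
      rcases Nat.lt_succ_iff_lt_or_eq.1 hi with hi | rfl
      · rw [Function.update_of_ne hi.ne]; exact hqS _ hi
      · simpa using hwS
    · intro i hi
      rw [Function.update_of_ne (by omega : i ≠ j)]
      rcases Nat.lt_succ_iff_lt_or_eq.1 hi with hi | hi
      · rw [Function.update_of_ne hi.ne]; exact hqA _ hi
      · rw [hi, Function.update_self]; exact hwA _ hi

lemma SimpleGraph.sum_degree_le_of_no_path (G : SimpleGraph V) (K : ℕ) (S : Finset V)
    (h : ∀ q, ¬ G.IsPathIn S K q) :
    ∑ v ∈ S, #(G.neighborFinset v ∩ S) ≤ 2 * K * #S := by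
  induction hn : #S generalizing S with
  | zero => simp [card_eq_zero.1 hn]
  | succ n ih =>
    have hS : S.Nonempty := card_pos.1 (by omega)
    obtain ⟨v, hv, hvK⟩ : ∃ v ∈ S, #(G.neighborFinset v ∩ S) < K := by
      by_contra! hc
      obtain ⟨q, hq⟩ := G.exists_isPathIn_of_degree S hS K hc
      exact h q hq
    have ih' := ih (S.erase v) (fun q hq => h q ⟨hq.1, fun i hi => (mem_erase.1 (hq.2.1 i hi)).2,
      hq.2.2⟩) (by rw [card_erase_of_mem hv]; omega)
    have h1 : ∀ u ∈ S.erase v, #(G.neighborFinset u ∩ S) ≤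
        #(G.neighborFinset u ∩ S.erase v) + if G.Adj v u then 1 else 0 := by
      intro u _
      rw [inter_erase]
      split_ifs with hu
      · rw [card_erase_of_mem (by simp [hu.symm, hv])]; omega
      · rw [erase_eq_of_notMem]
        · simp
        · simp [G.adj_comm u v, hu]
    have h2 : ∑ u ∈ S.erase v, (if G.Adj v u then 1 else 0) ≤ #(G.neighborFinset v ∩ S) := by
      rw [← card_filter]
      refine card_le_card fun u hu => ?_
      simp only [mem_filter, mem_erase] at hu
      simp [hu]
    have h3 := sum_le_sum h1
    rw [sum_add_distrib] at h3
    rw [← add_sum_erase S _ hv]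
    nlinarith

/-- A maximal family of disjoint paths on `K` vertices. -/
lemma SimpleGraph.exists_path_family (G : SimpleGraph V) (K : ℕ) (hK : 0 < K) :
    ∃ (m : ℕ) (P : Fin m × Fin K → V), Function.Injective P ∧
      (∀ i (j j' : Fin K), (j' : ℕ) = j + 1 → G.Adj (P (i, j)) (P (i, j'))) ∧
      m * K ≤ Fintype.card V ∧ ∀ q, ¬ G.IsPathIn (Set.range P)ᶜ K q := by
  let Q : ℕ → Prop := fun m => ∃ P : Fin m × Fin K → V, Function.Injective P ∧
      (∀ i (j j' : Fin K), (j' : ℕ) = j + 1 → G.Adj (P (i, j)) (P (i, j')))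
  have hb : ∀ m, Q m → m * K ≤ Fintype.card V := by
    rintro m ⟨P, hP, -⟩
    simpa using Fintype.card_le_of_injective P hP
  have hb' : ∀ m, Q m → m ≤ Fintype.card V := fun m hm =>
    (Nat.le_mul_of_pos_right m hK).trans (hb m hm)
  have hQ0 : Q 0 := ⟨fun x => x.1.elim0, fun x => x.1.elim0, fun i => i.elim0⟩
  set m := Nat.findGreatest Q (Fintype.card V) with hm
  have hQm : Q m := Nat.findGreatest_spec (P := Q) (Nat.zero_le _) hQ0
  have hmax : ¬ Q (m + 1) := fun h =>
    absurd (Nat.le_findGreatest (hb' _ h) h) (by omega)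
  obtain ⟨P, hP, hPA⟩ := hQm
  refine ⟨m, P, hP, hPA, hb m ⟨P, hP, hPA⟩, fun q hq => hmax ?_⟩
  obtain ⟨hq, hqS, hqA⟩ := hq
  refine ⟨fun x => Fin.lastCases (motive := fun _ => V) (q x.2) (fun i => P (i, x.2)) x.1, ?_, ?_⟩
  · rintro ⟨a, a'⟩ ⟨b, b'⟩ hab
    induction a using Fin.lastCases <;> induction b using Fin.lastCases <;>
      simp only [Fin.lastCases_last, Fin.lastCases_castSucc] at hab
    · have := hq a'.2 b'.2 hab
      rw [Fin.ext this]
    · exact absurd ⟨_, hab.symm⟩ (hqS _ a'.2)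
    · exact absurd ⟨_, hab⟩ (hqS _ b'.2)
    · have := hP hab
      simp only [Prod.mk.injEq] at this
      rw [this.1, this.2]
  · intro i j j' hj
    induction i using Fin.lastCases
    · simp only [Fin.lastCases_last, hj]
      exact hqA _ (by omega)
    · simp only [Fin.lastCases_castSucc]
      exact hPA _ _ _ hj

lemma exists_matching {V : Type*} (E : Finset (V × V)) (D : ℕ)
    (h1 : ∀ v, #(E.filter fun e => e.1 = v) ≤ D) (h2 : ∀ v, #(E.filter fun e => e.2 = v) ≤ D) :
    ∃ M ⊆ E, Set.InjOn Prod.fst (M : Set (V × V)) ∧ Set.InjOn Prod.snd (M : Set (V × V)) ∧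
      #E ≤ 2 * D * #M := by
  let Q : Finset (Finset (V × V)) := E.powerset.filter fun M =>
    Set.InjOn Prod.fst (M : Set (V × V)) ∧ Set.InjOn Prod.snd (M : Set (V × V))
  obtain ⟨M, hM, hmax⟩ := exists_max_image Q card ⟨∅, by simp [Q]⟩
  simp only [Q, mem_filter, mem_powerset] at hM hmax
  refine ⟨M, hM.1, hM.2.1, hM.2.2, ?_⟩
  have hcov : E ⊆ M.biUnion fun e => (E.filter fun f => f.1 = e.1) ∪ E.filter fun f => f.2 = e.2 := by
    intro f hf
    by_contra hc
    simp only [mem_biUnion, mem_union, mem_filter, hf, true_and, not_exists, not_and, not_or] at hc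
    have hfM : f ∉ M := fun h => (hc f h).1 rfl
    have := hmax (insert f M) ⟨insert_subset hf hM.1, ?_, ?_⟩
    · rw [card_insert_of_notMem hfM] at this
      omega
    · rw [coe_insert, Set.injOn_insert (by simpa using hfM)]
      refine ⟨hM.2.1, ?_⟩
      rintro ⟨e, he, hef⟩
      exact (hc e he).1 hef.symm
    · rw [coe_insert, Set.injOn_insert (by simpa using hfM)]
      refine ⟨hM.2.2, ?_⟩
      rintro ⟨e, he, hef⟩
      exact (hc e he).2 hef.symm
  refine (card_le_card hcov).trans (card_biUnion_le.trans ?_)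
  refine (sum_le_card_nsmul M _ (2 * D) fun e _ => (card_union_le _ _).trans ?_).trans ?_
  · have := h1 e.1; have := h2 e.2; omega
  · simp [mul_comm]

lemma two_mul_card_colorings_ne {β : Type*} [Fintype β] {x y : β} (hxy : x ≠ y) :
    2 * #(univ.filter fun χ : β → Bool => χ x ≠ χ y) = Fintype.card (β → Bool) := by
  have h : #(univ.filter fun χ : β → Bool => χ x ≠ χ y) =
      #(univ.filter fun χ : β → Bool => ¬ χ x ≠ χ y) := by
    refine card_nbij' (fun χ => Function.update χ x (!χ x)) (fun χ => Function.update χ x (!χ x))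
      ?_ ?_ ?_ ?_
    · intro χ; cases h : χ x <;> cases h' : χ y <;> simp [Function.update_of_ne hxy.symm, h, h']
    · intro χ; cases h : χ x <;> cases h' : χ y <;> simp [Function.update_of_ne hxy.symm, h, h']
    · intro χ _; simp
    · intro χ _; simp
  have h2 := card_filter_add_card_filter_not (s := (univ : Finset (β → Bool)))
    (fun χ : β → Bool => χ x ≠ χ y)
  rw [card_univ] at h2
  omega

lemma exists_cut {V β : Type*} [Fintype β] (b : V → β) (b₀ : β) (R : Finset (V × V))
    (hR : ∀ e ∈ R, b e.1 ≠ b e.2) (hsymm : ∀ e ∈ R, e.swap ∈ R) :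
    ∃ χ : β → Bool, χ b₀ = false ∧
      #R ≤ 4 * #(R.filter fun e => χ (b e.1) = true ∧ χ (b e.2) = false) := by
  have key : ∃ χ : β → Bool, #R ≤ 2 * #(R.filter fun e => χ (b e.1) ≠ χ (b e.2)) := by
    by_contra! hc
    have h1 : ∑ χ : β → Bool, 2 * #(R.filter fun e => χ (b e.1) ≠ χ (b e.2)) <
        ∑ χ : β → Bool, #R := sum_lt_sum_of_nonempty univ_nonempty fun χ _ => hc χ
    have h2 : ∑ χ : β → Bool, 2 * #(R.filter fun e => χ (b e.1) ≠ χ (b e.2)) =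
        ∑ e ∈ R, Fintype.card (β → Bool) := by
      simp_rw [← mul_sum, card_filter]
      rw [sum_comm, mul_sum]
      refine sum_congr rfl fun e he => ?_
      rw [← two_mul_card_colorings_ne (hR e he), card_filter]
    rw [h2] at h1
    simp [mul_comm] at h1
  obtain ⟨χ, hχ⟩ := key
  refine ⟨fun i => xor (χ i) (χ b₀), by simp, ?_⟩
  have h3 : ∀ χ' : β → Bool, #(R.filter fun e => χ' (b e.1) = true ∧ χ' (b e.2) = false) =
      #(R.filter fun e => χ' (b e.1) = false ∧ χ' (b e.2) = true) := fun χ' =>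
    card_nbij' Prod.swap Prod.swap
      (fun e he => by
        simp only [coe_filter, Set.mem_ofPred_eq] at he ⊢
        exact ⟨hsymm e he.1, he.2.2, he.2.1⟩)
      (fun e he => by
        simp only [coe_filter, Set.mem_ofPred_eq] at he ⊢
        exact ⟨hsymm e he.1, he.2.2, he.2.1⟩)
      (fun e _ => Prod.swap_swap e) (fun e _ => Prod.swap_swap e)
  have h4 : (R.filter fun e => χ (b e.1) ≠ χ (b e.2)) ⊆
      (R.filter fun e => xor (χ (b e.1)) (χ b₀) = true ∧ xor (χ (b e.2)) (χ b₀) = false) ∪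
      (R.filter fun e => xor (χ (b e.1)) (χ b₀) = false ∧ xor (χ (b e.2)) (χ b₀) = true) := by
    intro e he
    simp only [mem_filter, mem_union] at he ⊢
    obtain ⟨he, h⟩ := he
    revert h
    cases χ (b e.1) <;> cases χ (b e.2) <;> cases χ b₀ <;> simp [he]
  have h5 := (card_le_card h4).trans (card_union_le _ _)
  have h6 := h3 fun i => xor (χ i) (χ b₀)
  simp only at h6 ⊢
  omega

lemma SimpleGraph.isAcyclic_of_rank {V : Type*} (F : SimpleGraph V) (r : V → ℕ)
    (h : ∀ v x y, F.Adj v x → F.Adj v y → r x ≤ r v → r y ≤ r v → x = y) : F.IsAcyclic := by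
  intro v c hc
  obtain ⟨u, hu, hmax⟩ := exists_max_image c.support.toFinset r ⟨v, by simp⟩
  rw [List.mem_toFinset] at hu
  have hc' := hc.rotate hu
  have hmem : ∀ x ∈ (c.rotate u hu).support, r x ≤ r u := fun x hx =>
    hmax x (by simpa [SimpleGraph.Walk.mem_support_rotate_iff] using hx)
  exact hc'.snd_ne_penultimate (h u _ _ ((c.rotate u hu).adj_snd hc'.not_nil)
    ((c.rotate u hu).adj_penultimate hc'.not_nil).symm
    (hmem _ (SimpleGraph.Walk.getVert_mem_support _ _))
    (hmem _ (SimpleGraph.Walk.getVert_mem_support _ _)))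

lemma SimpleGraph.IsTree.card_adj_pairs {V : Type*} [Fintype V] {T : SimpleGraph V}
    (hT : T.IsTree) :
    #(univ.filter fun e : V × V => T.Adj e.1 e.2) + 2 = 2 * Fintype.card V := by
  have h1 : #(univ.filter fun e : V × V => T.Adj e.1 e.2) = ∑ v, T.degree v := by
    rw [card_filter, Fintype.sum_prod_type]
    refine sum_congr rfl fun v _ => ?_
    rw [← card_filter, ← SimpleGraph.card_neighborFinset_eq_degree]
    congr 1
    ext w
    simp
  have h2 := hT.card_edgeFinset
  rw [h1, T.sum_degrees_eq_twice_card_edges]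
  omega

/-- The graph obtained from `T` by detaching the vertices of `L` and reattaching each `x ∈ L` as a
leaf at `h x`. -/
def SimpleGraph.reattach {V : Type*} (T : SimpleGraph V) (L : Finset V) (h : V → V) :
    SimpleGraph V where
  Adj x y := (x ∉ L ∧ y ∉ L ∧ T.Adj x y) ∨ (x ∈ L ∧ y ∉ L ∧ h x = y) ∨ (y ∈ L ∧ x ∉ L ∧ h y = x)
  symm := ⟨fun x y => by
    rintro (⟨hx, hy, e⟩ | h | h)
    · exact Or.inl ⟨hy, hx, e.symm⟩
    · exact Or.inr (Or.inr h)
    · exact Or.inr (Or.inl h)⟩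
  loopless := ⟨fun x => by
    rintro (⟨_, _, e⟩ | h | h)
    · exact T.loopless.irrefl _ e
    · exact h.2.1 h.1
    · exact h.2.1 h.1⟩

lemma SimpleGraph.IsTree.reattach {V : Type*} [Fintype V] {T : SimpleGraph V} (hT : T.IsTree)
    (L : Finset V) (g h : V → V) (hg : ∀ l ∈ L, ∀ y, T.Adj l y ↔ y = g l)
    (hgL : ∀ l ∈ L, g l ∉ L) (hhL : ∀ l ∈ L, h l ∉ L) : (T.reattach L h).IsTree := by
  let π : V → V := fun v => if v ∈ L then g v else v
  have hadj : ∀ x y, T.Adj x y → (T.reattach L h).Reachable (π x) (π y) := by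
    intro x y e
    by_cases hx : x ∈ L
    · have hy := (hg x hx y).1 e
      simp [π, hx, hy, hgL x hx]
    · by_cases hy : y ∈ L
      · have hx' := (hg y hy x).1 e.symm
        simp [π, hy, hx', hgL y hy]
      · simp only [π, hx, hy, if_false]
        exact SimpleGraph.Adj.reachable (Or.inl ⟨hx, hy, e⟩)
  have hreach : ∀ x y, T.Reachable x y → (T.reattach L h).Reachable (π x) (π y) := by
    rintro x y ⟨p⟩
    induction p with
    | nil => exact SimpleGraph.Reachable.refl _
    | cons e _ ih => exact (hadj _ _ e).trans ih
  have hcore : ∀ x, ∃ c, π c = c ∧ (T.reattach L h).Reachable x c := by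
    intro x
    by_cases hx : x ∈ L
    · exact ⟨h x, by simp [π, hhL x hx],
        SimpleGraph.Adj.reachable (Or.inr (Or.inl ⟨hx, hhL x hx, rfl⟩))⟩
    · exact ⟨x, by simp [π, hx], SimpleGraph.Reachable.refl _⟩
  have hne := hT.connected.nonempty
  have hconn : (T.reattach L h).Connected := by
    refine SimpleGraph.Connected.mk fun x y => ?_
    obtain ⟨c, hc, hxc⟩ := hcore x
    obtain ⟨d, hd, hyd⟩ := hcore y
    have := hreach c d (hT.connected.preconnected c d)
    rw [hc, hd] at this
    exact hxc.trans (this.trans hyd.symm)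
  have hsub : (T.reattach L h).edgeFinset ⊆
      (T.edgeFinset \ L.image fun l => s(l, g l)) ∪ L.image fun l => s(l, h l) := by
    intro e
    induction e with
    | h x y =>
      simp only [mem_edgeFinset, mem_edgeSet, mem_union, mem_sdiff, mem_image]
      rintro (⟨hx, hy, e⟩ | ⟨hx, hy, rfl⟩ | ⟨hx, hy, rfl⟩)
      · refine Or.inl ⟨e, ?_⟩
        rintro ⟨l, hl, hl'⟩
        rcases Sym2.eq_iff.1 hl' with ⟨rfl, _⟩ | ⟨rfl, _⟩
        · exact hx hl
        · exact hy hl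
      · exact Or.inr ⟨x, hx, rfl⟩
      · exact Or.inr ⟨y, hx, Sym2.eq_swap⟩
  have hinj : #(L.image fun l => s(l, g l)) = #L := by
    refine card_image_of_injOn fun a ha b hb hab => ?_
    rcases Sym2.eq_iff.1 hab with ⟨h, _⟩ | ⟨h, _⟩
    · exact h
    · exact absurd ha (h ▸ hgL b hb)
  have himg : (L.image fun l => s(l, g l)) ⊆ T.edgeFinset := by
    intro e he
    obtain ⟨l, hl, rfl⟩ := mem_image.1 he
    simpa using (hg l hl (g l)).2 rfl
  have h1 := (card_le_card hsub).trans (card_union_le _ _)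
  have h2 : #(L.image fun l => s(l, h l)) ≤ #L := card_image_le
  rw [card_sdiff_of_subset himg, hinj] at h1
  have h3 := hT.card_edgeFinset
  have h4 := card_le_card himg
  rw [hinj] at h4
  have h5 := hconn.card_vert_le_card_edgeSet_add_one
  rw [SimpleGraph.isTree_iff_connected_and_card]
  refine ⟨hconn, ?_⟩
  rw [Nat.card_eq_fintype_card, Nat.card_eq_fintype_card, ← SimpleGraph.edgeFinset_card] at h5 ⊢
  omega

/-- A vertex with at least two neighbours. -/
def SimpleGraph.IsBranching {V : Type*} (T : SimpleGraph V) (v : V) : Prop :=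
  ∃ x y, x ≠ y ∧ T.Adj v x ∧ T.Adj v y

lemma SimpleGraph.Iso.isBranching {V W : Type*} {T : SimpleGraph V} {T' : SimpleGraph W}
    (σ : T ≃g T') {v : V} (h : T.IsBranching v) : T'.IsBranching (σ v) := by
  obtain ⟨x, y, hxy, hx, hy⟩ := h
  exact ⟨σ x, σ y, σ.injective.ne hxy, σ.map_adj_iff.2 hx, σ.map_adj_iff.2 hy⟩

/-- Two isomorphisms from `T₀` onto trees with the same core `Lᶜ` agree on the branching vertices
when they agree on an edge and read the same labels around the vertices of `B`, the other
vertices of the core having at most two neighbours in it. -/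
lemma SimpleGraph.Iso.eq_of_labels_eq {V α : Type*} {T₀ T T' K : SimpleGraph V}
    (σ : T₀ ≃g T) (σ' : T₀ ≃g T') (L B : Finset V)
    (hT : ∀ x ∉ L, ∀ y ∉ L, (T.Adj x y ↔ K.Adj x y))
    (hT' : ∀ x ∉ L, ∀ y ∉ L, (T'.Adj x y ↔ K.Adj x y))
    (hL : ∀ v, T.IsBranching v → v ∉ L) (hL' : ∀ v, T'.IsBranching v → v ∉ L)
    (hB : ∀ b ∉ L, b ∉ B → ∀ x ∉ L, ∀ y ∉ L, ∀ z ∉ L, K.Adj b x → K.Adj b y → K.Adj b z →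
      x ≠ y → x ≠ z → y = z)
    (lab : V → V → α) (hlab : ∀ v x y, T₀.Adj v x → T₀.Adj v y → lab v x = lab v y → x = y)
    (hcode : ∀ b ∈ B, b ∉ L → ∀ w ∉ L, K.Adj b w →
      lab (σ.symm b) (σ.symm w) = lab (σ'.symm b) (σ'.symm w))
    (hconn : T₀.Connected) {r₀ r₁ : V} (hr : T₀.Adj r₁ r₀) (hr₀ : T₀.IsBranching r₀)
    (hr₁ : T₀.IsBranching r₁) (h₀ : σ r₀ = σ' r₀) (h₁ : σ r₁ = σ' r₁) {y : V}
    (hy : T₀.IsBranching y) : σ y = σ' y := by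
  have step : ∀ x y z, T₀.Adj x y → T₀.Adj y z → T₀.IsBranching x → T₀.IsBranching y →
      T₀.IsBranching z → σ x = σ' x → σ y = σ' y → σ z = σ' z := by
    intro x y z hxy hyz bx bY bz ex ey
    have cx := hL _ (σ.isBranching bx)
    have cy := hL _ (σ.isBranching bY)
    have cz := hL _ (σ.isBranching bz)
    have cz' := hL' _ (σ'.isBranching bz)
    have ax : K.Adj (σ y) (σ x) := (hT _ cy _ cx).1 (σ.map_adj_iff.2 hxy.symm)
    have az : K.Adj (σ y) (σ z) := (hT _ cy _ cz).1 (σ.map_adj_iff.2 hyz)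
    have az' : K.Adj (σ y) (σ' z) := by
      rw [ey] at cy ⊢
      exact (hT' _ cy _ cz').1 (σ'.map_adj_iff.2 hyz)
    by_cases hb : σ y ∈ B
    · have h := hcode _ hb cy _ cz az
      rw [RelIso.symm_apply_apply, RelIso.symm_apply_apply, ey, RelIso.symm_apply_apply] at h
      have h' := hlab y z (σ'.symm (σ z)) hyz ?_ h
      · have h'' := congrArg σ' h'
        rw [RelIso.apply_symm_apply] at h''
        exact h''.symm
      · rw [← σ'.map_adj_iff, RelIso.apply_symm_apply, ← ey]
        exact (hT' _ cy _ cz).2 az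
    · by_cases hzx : z = x
      · rw [hzx, ex]
      · refine hB _ cy hb _ cx _ cz _ cz' ax az az' (σ.injective.ne (Ne.symm hzx)) ?_
        rw [ex]
        exact σ'.injective.ne (Ne.symm hzx)
  obtain ⟨p, hp⟩ := (hconn.preconnected r₀ y).exists_isPath
  induction p generalizing r₁ with
  | nil => exact h₀
  | @cons u v w e p ih =>
    have hv : T₀.IsBranching v := by
      cases p with
      | nil => exact hy
      | @cons _ v' _ e' p =>
        refine ⟨u, v', ?_, e.symm, e'⟩
        rintro rfl
        simp at hp
    exact ih e hv hr₀ (step _ _ _ hr e hr₁ hr₀ hv h₁ h₀) h₀ hy hp.of_cons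

lemma exists_pairwise_not_iso {V : Type*} (X : Finset (SimpleGraph V)) (N : ℕ)
    (h : ∀ T ∈ X, #(X.filter fun T' => Nonempty (T ≃g T')) ≤ N) :
    ∃ S ⊆ X, (∀ T ∈ S, ∀ T' ∈ S, T ≠ T' → IsEmpty (T ≃g T')) ∧ #X ≤ N * #S := by
  let Q : Finset (Finset (SimpleGraph V)) := X.powerset.filter fun S =>
    ∀ T ∈ S, ∀ T' ∈ S, T ≠ T' → IsEmpty (T ≃g T')
  obtain ⟨S, hS, hmax⟩ := exists_max_image Q card ⟨∅, by simp [Q]⟩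
  simp only [Q, mem_filter, mem_powerset] at hS hmax
  refine ⟨S, hS.1, hS.2, ?_⟩
  have hcov : X ⊆ S.biUnion fun T => X.filter fun T' => Nonempty (T ≃g T') := by
    intro T' hT'
    by_contra hc
    simp only [mem_biUnion, mem_filter, hT', true_and, not_exists, not_and,
      not_nonempty_iff] at hc
    have hT'S : T' ∉ S := fun h => (hc T' h).false SimpleGraph.Iso.refl
    have hc' : ∀ T ∈ S, IsEmpty (T' ≃g T) := fun T hT => ⟨fun e => (hc T hT).false e.symm⟩
    have := hmax (insert T' S) ⟨insert_subset hT' hS.1, fun A hA B hB hAB => ?_⟩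
    · rw [card_insert_of_notMem hT'S] at this
      omega
    · rcases mem_insert.1 hA with rfl | hA' <;> rcases mem_insert.1 hB with rfl | hB'
      · exact absurd rfl hAB
      · exact hc' B hB'
      · exact ⟨fun e => (hc' A hA').false e.symm⟩
      · exact hS.2 A hA' B hB' hAB
  refine (card_le_card hcov).trans (card_biUnion_le.trans ?_)
  refine (sum_le_card_nsmul S _ N fun T hT => h T (hS.1 hT)).trans ?_
  simp [mul_comm]

lemma SimpleGraph.exists_labelling {V : Type*} [Fintype V] (G : SimpleGraph V) (D : ℕ)
    (hD : ∀ v, G.degree v ≤ D) :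
    ∃ lab : V → V → Fin (D + 1), ∀ v x y, G.Adj v x → G.Adj v y → lab v x = lab v y → x = y := by
  have : ∀ v, ∃ f : V → Fin (D + 1), Set.InjOn f (G.neighborFinset v) := by
    intro v
    obtain ⟨f⟩ := Function.Embedding.nonempty_of_card_le (α := G.neighborFinset v)
      (β := Fin (D + 1)) (by
        rw [Fintype.card_coe, card_neighborFinset_eq_degree, Fintype.card_fin]
        exact (hD v).trans (Nat.le_succ D))
    refine ⟨fun x => if hx : x ∈ G.neighborFinset v then f ⟨x, hx⟩ else 0, fun x hx y hy h => ?_⟩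
    rw [mem_coe] at hx hy
    simp only [hx, hy, dif_pos] at h
    exact congrArg Subtype.val (f.injective h)
  choose lab hlab using this
  exact ⟨lab, fun v x y hx hy h => hlab v (by simpa using hx) (by simpa using hy) h⟩

lemma SimpleGraph.IsTree.exists_pairwise_not_iso {V : Type*} [Fintype V] {G T : SimpleGraph V}
    (hT : T.IsTree) (hTG : T ≤ G) (L : Finset V) (g : V → V)
    (hg : ∀ l ∈ L, ∀ y, T.Adj l y ↔ y = g l) (hgL : ∀ l ∈ L, g l ∉ L)
    (M : Finset V) (hM : M ⊆ L) (μ : V → V) (hμ : Set.InjOn μ M) (hμL : ∀ l ∈ M, μ l ∉ L)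
    (hμG : ∀ l ∈ M, G.Adj l (μ l)) (hμg : ∀ l ∈ M, ∀ l' ∈ L, g l' ≠ μ l)
    (hμT : ∀ l ∈ M, ∃ w ∉ L, T.Adj (μ l) w)
    (x₀ x₁ : V) (hx₀ : x₀ ∉ L) (hx₁ : x₁ ∉ L) (hx : T.Adj x₀ x₁)
    (hx₀' : ∃ y ∉ L, y ≠ x₁ ∧ T.Adj x₀ y) (hx₁' : ∃ y ∉ L, y ≠ x₀ ∧ T.Adj x₁ y)
    (B : Finset V)
    (hB : ∀ b ∉ L, b ∉ B → ∀ x ∉ L, ∀ y ∉ L, ∀ z ∉ L, T.Adj b x → T.Adj b y → T.Adj b z →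
      x ≠ y → x ≠ z → y = z)
    (D s : ℕ) (hD : ∀ v, G.degree v ≤ D)
    (hs : #(univ.filter fun e : V × V => e.1 ∈ B ∧ e.1 ∉ L ∧ e.2 ∉ L ∧ T.Adj e.1 e.2) ≤ s) :
    ∃ S : Finset (SimpleGraph V), (∀ T ∈ S, T ≤ G ∧ T.IsTree) ∧
      (∀ T ∈ S, ∀ T' ∈ S, T ≠ T' → IsEmpty (T ≃g T')) ∧
      2 ^ #M ≤ Fintype.card V * (Fintype.card V * (D + 1) ^ s) * #S := by
  let h : Finset V → V → V := fun S v => if v ∈ S then μ v else g v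
  let F : Finset V → SimpleGraph V := fun S => T.reattach L (h S)
  have hhL : ∀ S ⊆ M, ∀ l ∈ L, h S l ∉ L := fun S hS l hl => by
    by_cases hlS : l ∈ S
    · simpa [h, hlS] using hμL l (hS hlS)
    · simpa [h, hlS] using hgL l hl
  have hFtree : ∀ S ⊆ M, (F S).IsTree := fun S hS =>
    hT.reattach L g (h S) hg hgL (hhL S hS)
  have hhG : ∀ S ⊆ M, ∀ l ∈ L, G.Adj l (h S l) := fun S hS l hl => by
    by_cases hlS : l ∈ S
    · simpa [h, hlS] using hμG l (hS hlS)
    · simpa [h, hlS] using hTG ((hg l hl _).2 rfl)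
  have hFG : ∀ S ⊆ M, F S ≤ G := by
    rintro S hS x y (⟨-, -, e⟩ | ⟨hx, -, rfl⟩ | ⟨hy, -, rfl⟩)
    · exact hTG e
    · exact hhG S hS x hx
    · exact (hhG S hS y hy).symm
  have hcore : ∀ S, ∀ x ∉ L, ∀ y ∉ L, ((F S).Adj x y ↔ T.Adj x y) := fun S x hx y hy => by
    simp [F, SimpleGraph.reattach, hx, hy]
  have hleaf : ∀ S, ∀ v, (F S).IsBranching v → v ∉ L := by
    rintro S v ⟨x, y, hxy, hvx, hvy⟩ hv
    simp only [F, SimpleGraph.reattach, hv, not_true_eq_false, false_and, true_and, false_or,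
      and_false, or_false] at hvx hvy
    exact hxy (hvx.2.symm.trans hvy.2)
  have hadj : ∀ S ⊆ M, ∀ l ∈ M, ((F S).Adj (μ l) l ↔ l ∈ S) := by
    intro S hS l hl
    simp only [F, SimpleGraph.reattach, hM hl, hμL l hl, not_true_eq_false, false_and, true_and,
      false_or, and_false, not_false_eq_true]
    by_cases hlS : l ∈ S
    · simp [h, hlS]
    · simpa [h, hlS] using hμg l hl l (hM hl)
  have hFinj : Set.InjOn F (M.powerset : Set (Finset V)) := by
    intro S hS S' hS' e
    simp only [coe_powerset, Set.mem_preimage, Set.mem_powerset_iff, coe_subset] at hS hS'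
    ext l
    by_cases hl : l ∈ M
    · rw [← hadj S hS l hl, ← hadj S' hS' l hl, e]
    · exact ⟨fun h => absurd (hS h) hl, fun h => absurd (hS' h) hl⟩
  have hbr₀ : ∀ S, (F S).IsBranching x₀ := fun S => by
    obtain ⟨y, hy, hyx, e⟩ := hx₀'
    exact ⟨y, x₁, hyx, (hcore S _ hx₀ _ hy).2 e, (hcore S _ hx₀ _ hx₁).2 hx⟩
  have hbr₁ : ∀ S, (F S).IsBranching x₁ := fun S => by
    obtain ⟨y, hy, hyx, e⟩ := hx₁'
    exact ⟨y, x₀, hyx, (hcore S _ hx₁ _ hy).2 e, (hcore S _ hx₁ _ hx₀).2 hx.symm⟩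
  obtain ⟨lab, hlab⟩ := G.exists_labelling D hD
  set 𝒟 := univ.filter fun e : V × V => e.1 ∈ B ∧ e.1 ∉ L ∧ e.2 ∉ L ∧ T.Adj e.1 e.2 with h𝒟
  have hclass : ∀ T₀ ∈ M.powerset.image F,
      #((M.powerset.image F).filter fun T' => Nonempty (T₀ ≃g T')) ≤
        Fintype.card V * (Fintype.card V * (D + 1) ^ s) := by
    intro T₀ hT₀
    obtain ⟨S₀, hS₀, rfl⟩ := mem_image.1 hT₀
    rw [mem_powerset] at hS₀
    rw [filter_image]
    refine card_image_le.trans ?_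
    have hmem : ∀ {S}, S ∈ M.powerset.filter (fun S => Nonempty (F S₀ ≃g F S)) →
        S ⊆ M ∧ Nonempty (F S₀ ≃g F S) := fun hS => by simpa using hS
    let σ : ∀ S, Nonempty (F S₀ ≃g F S) → (F S₀ ≃g F S) := fun S hS => hS.some
    let code : Finset V → V × V × (𝒟 → Fin (D + 1)) := fun S =>
      if hS : Nonempty (F S₀ ≃g F S) then
        (σ S hS x₀, σ S hS x₁, fun e => lab ((σ S hS).symm e.1.1) ((σ S hS).symm e.1.2))
      else (x₀, x₁, fun _ => 0)
    have hcode : Set.InjOn code (M.powerset.filter (fun S => Nonempty (F S₀ ≃g F S)) :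
        Set (Finset V)) := by
      intro S hS S' hS' e
      obtain ⟨hSM, hS⟩ := hmem hS
      obtain ⟨hSM', hS'⟩ := hmem hS'
      simp only [code, dif_pos hS, dif_pos hS', Prod.mk.injEq] at e
      obtain ⟨e₀, e₁, e₂⟩ := e
      have hagree : ∀ y, (F S₀).IsBranching y → σ S hS y = σ S' hS' y := fun y hy =>
        SimpleGraph.Iso.eq_of_labels_eq (σ S hS) (σ S' hS') L B (hcore S) (hcore S') (hleaf S)
          (hleaf S') hB lab (fun v x y hx hy => hlab v x y (hFG S₀ hS₀ hx) (hFG S₀ hS₀ hy))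
          (fun b hb hbL w hw hbw => congrFun e₂ ⟨(b, w), by simp [h𝒟, hb, hbL, hw, hbw]⟩)
          (hFtree S₀ hS₀).connected ((hcore S₀ _ hx₁ _ hx₀).2 hx.symm) (hbr₀ S₀) (hbr₁ S₀) e₀ e₁ hy
      have key : ∀ R R' (ρ : F S₀ ≃g F R) (ρ' : F S₀ ≃g F R'), R ⊆ M → R' ⊆ M →
          (∀ y, (F S₀).IsBranching y → ρ y = ρ' y) → R ⊆ R' := by
        intro R R' ρ ρ' hR hR' hag l hl
        by_contra hl'
        have hlM := hR hl
        obtain ⟨w, hw, hwT⟩ := hμT l hlM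
        have hb : (F R).IsBranching (μ l) :=
          ⟨w, l, fun e => hw (e ▸ hM hlM), (hcore R _ (hμL l hlM) _ hw).2 hwT,
            (hadj R hR l hlM).2 hl⟩
        have hy : (F S₀).IsBranching (ρ.symm (μ l)) := ρ.symm.isBranching hb
        have hρ' : ρ' (ρ.symm (μ l)) = μ l := by
          rw [← hag _ hy, RelIso.apply_symm_apply]
        have d1 : (F R).degree (μ l) = (F R').degree (μ l) := by
          have h1 := ρ.degree_eq (ρ.symm (μ l))
          have h2 := ρ'.degree_eq (ρ.symm (μ l))
          rw [RelIso.apply_symm_apply] at h1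
          rw [hρ'] at h2
          exact h1.trans h2.symm
        have hss : (F R').neighborFinset (μ l) ⊂ (F R).neighborFinset (μ l) := by
          rw [Finset.ssubset_iff_of_subset]
          · exact ⟨l, by simpa using (hadj R hR l hlM).2 hl, by
              simpa using fun e => hl' ((hadj R' hR' l hlM).1 e)⟩
          · intro v hv
            simp only [mem_neighborFinset] at hv ⊢
            rcases hv with ⟨_, hv, e⟩ | ⟨hv, _⟩ | ⟨hv, _, e⟩
            · exact (hcore R _ (hμL l hlM) _ hv).2 e
            · exact absurd hv (hμL l hlM)
            · by_cases hvR : v ∈ R'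
              · simp only [h, hvR, if_true] at e
                exact absurd (hμ (hR' hvR) hlM e ▸ hvR) hl'
              · simp only [h, hvR, if_false] at e
                exact absurd e (hμg l hlM v hv)
        have := card_lt_card hss
        simp only [SimpleGraph.card_neighborFinset_eq_degree] at this
        omega
      exact Subset.antisymm (key S S' _ _ hSM hSM' hagree)
        (key S' S _ _ hSM' hSM fun y hy => (hagree y hy).symm)
    have := card_le_card_of_injOn code (t := univ) (fun _ _ => mem_univ _) hcode
    refine this.trans ?_
    simp only [card_univ, Fintype.card_prod, Fintype.card_fun, Fintype.card_fin,
      Fintype.card_coe]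
    gcongr
    omega
  obtain ⟨S, hSX, hS, hcard⟩ := _root_.exists_pairwise_not_iso _ _ hclass
  refine ⟨S, fun A hA => ?_, hS, ?_⟩
  · obtain ⟨R, hR, rfl⟩ := mem_image.1 (hSX hA)
    exact ⟨hFG R (mem_powerset.1 hR), hFtree R (mem_powerset.1 hR)⟩
  · rwa [card_image_of_injOn hFinj, card_powerset] at hcard

/-- A forest given by a parent function (the roots are its fixed points) extends to a spanning tree
of `G`, which has few further edges. -/
lemma SimpleGraph.Connected.exists_isTree_of_parent {G : SimpleGraph V} (hG : G.Connected)
    (p : V → V) (r : V → ℕ) (hp : ∀ v, p v ≠ v → G.Adj v (p v) ∧ r (p v) < r v) :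
    ∃ T ≤ G, T.IsTree ∧ (∀ v, p v ≠ v → T.Adj v (p v)) ∧
      #(univ.filter fun e : V × V => T.Adj e.1 e.2 ∧ p e.1 ≠ e.2 ∧ p e.2 ≠ e.1) ≤
        2 * #(univ.filter fun v => p v = v) := by
  let F : SimpleGraph V :=
    { Adj := fun x y => x ≠ y ∧ (p x = y ∨ p y = x)
      symm := ⟨fun x y h => ⟨h.1.symm, h.2.symm⟩⟩
      loopless := ⟨fun x h => h.1 rfl⟩ }
  have hFG : F ≤ G := by
    rintro x y ⟨hxy, rfl | rfl⟩
    · exact (hp x hxy.symm).1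
    · exact (hp y hxy).1.symm
  have hF : F.IsAcyclic := by
    have key : ∀ v x, F.Adj v x → r x ≤ r v → x = p v := by
      rintro v x ⟨hvx, rfl | rfl⟩ h
      · rfl
      · exact absurd (hp x hvx).2 (by omega)
    exact F.isAcyclic_of_rank r fun v x y hx hy hrx hry =>
      (key v x hx hrx).trans (key v y hy hry).symm
  obtain ⟨T, hFT, hTG, hT⟩ := hG.exists_isTree_le_of_le_of_isAcyclic hFG hF
  have hTp : ∀ v, p v ≠ v → T.Adj v (p v) := fun v hv => hFT ⟨hv.symm, Or.inl rfl⟩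
  refine ⟨T, hTG, hT, hTp, ?_⟩
  let R : Finset V := univ.filter fun v => p v ≠ v
  let up : Finset (V × V) := R.image fun v => (v, p v)
  let down : Finset (V × V) := R.image fun v => (p v, v)
  have hup : #up = #R := card_image_of_injective _ fun a b h => (Prod.mk.inj h).1
  have hdown : #down = #R := card_image_of_injective _ fun a b h => (Prod.mk.inj h).2
  have hdisj : Disjoint up down := by
    rw [Finset.disjoint_left]
    intro e he he'
    obtain ⟨v, hv, rfl⟩ := mem_image.1 he
    obtain ⟨w, hw, h⟩ := mem_image.1 he'
    simp only [Prod.mk.injEq] at h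
    simp only [R, mem_filter, mem_univ, true_and] at hv hw
    have h1 := (hp v hv).2
    have h2 := (hp w hw).2
    rw [h.1, h.2] at h2
    omega
  have hdisj' : Disjoint (univ.filter fun e : V × V => T.Adj e.1 e.2 ∧ p e.1 ≠ e.2 ∧ p e.2 ≠ e.1)
      (up ∪ down) := by
    rw [Finset.disjoint_left]
    intro e he he'
    simp only [mem_filter, mem_univ, true_and] at he
    rcases mem_union.1 he' with h | h <;> obtain ⟨v, -, rfl⟩ := mem_image.1 h
    · exact he.2.1 rfl
    · exact he.2.2 rfl
  have hsub : (univ.filter fun e : V × V => T.Adj e.1 e.2 ∧ p e.1 ≠ e.2 ∧ p e.2 ≠ e.1) ∪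
      (up ∪ down) ⊆ univ.filter fun e : V × V => T.Adj e.1 e.2 := by
    intro e he
    simp only [mem_filter, mem_univ, true_and]
    rcases mem_union.1 he with h | h
    · exact (mem_filter.1 h).2.1
    · rcases mem_union.1 h with h | h <;> obtain ⟨v, hv, rfl⟩ := mem_image.1 h
      · exact hTp v (mem_filter.1 hv).2
      · exact (hTp v (mem_filter.1 hv).2).symm
  have h1 := card_le_card hsub
  rw [card_union_of_disjoint hdisj', card_union_of_disjoint hdisj, hup, hdown] at h1
  have h2 := hT.card_adj_pairs
  have h3 := card_filter_add_card_filter_not (s := (univ : Finset V)) (fun v => p v = v)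
  rw [card_univ] at h3
  have h4 : #R = #(univ.filter fun v => ¬ p v = v) := rfl
  omega

/-- Many pairwise non-isomorphic spanning trees from a forest consisting of paths on `U` and of
stars centred in `D₀`, if there are many edges between the paths and the leaves of the stars. -/
lemma SimpleGraph.Connected.exists_pairwise_not_iso_of_parent {G : SimpleGraph V}
    (hG : G.Connected) (p : V → V) (r : V → ℕ)
    (hp : ∀ v, p v ≠ v → G.Adj v (p v) ∧ r (p v) < r v) (U D₀ : Finset V)
    (hU : ∀ v ∈ U, p v ∈ U) (hinj : ∀ v ∈ U, ∀ w ∈ U, p v ≠ v → p w ≠ w → p v = p w → v = w)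
    (hnbr : ∀ u ∈ U, ∃ w ∈ U, w ≠ u ∧ (p u = w ∨ p w = u))
    (hroot : ∀ v ∈ D₀, v ∉ U → p v = v) (hstar : ∀ v ∉ U, v ∉ D₀ → p v ∈ D₀)
    (hlong : ∃ x ∈ U, p x ≠ x ∧ p (p x) ≠ p x ∧ p (p (p x)) ≠ p (p x))
    (E : Finset (V × V)) (hE : ∀ e ∈ E, e.1 ∉ U ∧ e.2 ∈ U ∧ G.Adj e.1 e.2)
    (Δ ρ : ℕ) (hΔ : ∀ v, G.degree v ≤ Δ) (hρ : #(univ.filter fun v => p v = v) ≤ ρ) :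
    ∃ (N : ℕ) (S : Finset (SimpleGraph V)), (∀ T ∈ S, T ≤ G ∧ T.IsTree) ∧
      (∀ T ∈ S, ∀ T' ∈ S, T ≠ T' → IsEmpty (T ≃g T')) ∧
      #E ≤ 2 * Δ * N + Δ * (2 * #D₀ + 2 * ρ) ∧
      2 ^ N ≤ Fintype.card V * (Fintype.card V * (Δ + 1) ^ (8 * ρ + 2 * #D₀)) * #S := by
  obtain ⟨T, hTG, hT, hTp, hX⟩ := hG.exists_isTree_of_parent p r hp
  set X := univ.filter fun e : V × V => T.Adj e.1 e.2 ∧ p e.1 ≠ e.2 ∧ p e.2 ≠ e.1 with hXdef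
  set Q := X.image Prod.fst with hQdef
  have hQ : #Q ≤ 2 * ρ := card_image_le.trans (hX.trans (by omega))
  have hTQ : ∀ x y, T.Adj x y → x ∉ Q → p x = y ∨ p y = x := by
    intro x y hxy hx
    by_contra! hc
    exact hx (mem_image.2 ⟨(x, y), by simp [hXdef, hxy, hc], rfl⟩)
  set L : Finset V := univ.filter fun v => v ∉ U ∧ v ∉ D₀ ∧ v ∉ Q with hLdef
  have hL : ∀ v, v ∈ L ↔ v ∉ U ∧ v ∉ D₀ ∧ v ∉ Q := by simp [hLdef]
  have hUL : ∀ v ∈ U, v ∉ L := fun v hv h => ((hL v).1 h).1 hv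
  have hDL : ∀ v ∈ D₀, v ∉ L := fun v hv h => ((hL v).1 h).2.1 hv
  have hpL : ∀ l ∈ L, p l ≠ l := fun l hl e => by
    have h := (hL l).1 hl
    exact h.2.1 (e ▸ hstar l h.1 h.2.1)
  have hg : ∀ l ∈ L, ∀ y, T.Adj l y ↔ y = p l := by
    intro l hl y
    have h := (hL l).1 hl
    refine ⟨fun e => ?_, fun e => e ▸ hTp l (hpL l hl)⟩
    rcases hTQ l y e h.2.2 with h' | h'
    · exact h'.symm
    · by_cases hyU : y ∈ U
      · exact absurd (h' ▸ hU y hyU) h.1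
      · by_cases hyD : y ∈ D₀
        · exact absurd ((hroot y hyD hyU).symm.trans h') e.ne'
        · exact absurd (h' ▸ hstar y hyU hyD) h.2.1
  have hgD : ∀ l ∈ L, p l ∈ D₀ := fun l hl => hstar l ((hL l).1 hl).1 ((hL l).1 hl).2.1
  have hchild : ∀ x ∉ L, ∀ b, T.Adj b x → p x = b → x ∈ U ∨ (x ∈ Q ∧ b ∈ D₀) := by
    intro x hx b hbx e
    by_contra! hc
    by_cases hxD : x ∈ D₀
    · exact hbx.ne (e.symm.trans (hroot x hxD hc.1))
    · refine hx ((hL x).2 ⟨hc.1, hxD, fun hxQ => hc.2 hxQ ?_⟩)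
      exact e ▸ hstar x hc.1 hxD
  set B := Q ∪ D₀ with hBdef
  have hBc : #B ≤ 2 * ρ + #D₀ := (card_union_le _ _).trans (by omega)
  have hB : ∀ b ∉ L, b ∉ B → ∀ x ∉ L, ∀ y ∉ L, ∀ z ∉ L, T.Adj b x → T.Adj b y → T.Adj b z →
      x ≠ y → x ≠ z → y = z := by
    intro b _ hbB
    have hbQ : b ∉ Q := fun h => hbB (mem_union_left _ h)
    have hbD : b ∉ D₀ := fun h => hbB (mem_union_right _ h)
    have key : ∀ x ∉ L, T.Adj b x → p b = x ∨ (x ∈ U ∧ p x ≠ x ∧ p x = b) := by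
      intro x hx hbx
      rcases hTQ b x hbx hbQ with h | h
      · exact Or.inl h
      · rcases hchild x hx b hbx h with h' | h'
        · exact Or.inr ⟨h', fun e => hbx.ne (h.symm.trans e), h⟩
        · exact absurd h'.2 hbD
    intro x hx y hy z hz ax ay az hxy hxz
    rcases key x hx ax with h1 | h1 <;> rcases key y hy ay with h2 | h2 <;>
      rcases key z hz az with h3 | h3
    · exact h2.symm.trans h3
    · exact absurd (h1.symm.trans h2) hxy
    · exact absurd (h1.symm.trans h3) hxz
    · exact hinj y h2.1 z h3.1 h2.2.1 h3.2.1 (h2.2.2.trans h3.2.2.symm)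
    · exact h2.symm.trans h3
    · exact absurd (hinj x h1.1 z h3.1 h1.2.1 h3.2.1 (h1.2.2.trans h3.2.2.symm)) hxz
    · exact absurd (hinj x h1.1 y h2.1 h1.2.1 h2.2.1 (h1.2.2.trans h2.2.2.symm)) hxy
    · exact absurd (hinj x h1.1 y h2.1 h1.2.1 h2.2.1 (h1.2.2.trans h2.2.2.symm)) hxy
  have hs : #(univ.filter fun e : V × V => e.1 ∈ B ∧ e.1 ∉ L ∧ e.2 ∉ L ∧ T.Adj e.1 e.2) ≤
      8 * ρ + 2 * #D₀ := by
    let Y : Finset (V × V) := univ.filter fun e => e.1 ∈ B ∧ e.2 ∈ U ∧ p e.2 ≠ e.2 ∧ p e.2 = e.1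
    have hY : #Y ≤ #B := by
      refine card_le_card_of_injOn Prod.fst (fun e he => (mem_filter.1 he).2.1) ?_
      intro e he f hf hef
      have he' := (mem_filter.1 he).2
      have hf' := (mem_filter.1 hf).2
      exact Prod.ext hef (hinj _ he'.2.1 _ hf'.2.1 he'.2.2.1 hf'.2.2.1
        (he'.2.2.2.trans (hef.trans hf'.2.2.2.symm)))
    have hsub : (univ.filter fun e : V × V => e.1 ∈ B ∧ e.1 ∉ L ∧ e.2 ∉ L ∧ T.Adj e.1 e.2) ⊆
        X ∪ (B.image fun v => (v, p v)) ∪ Y ∪ Q.image fun v => (p v, v) := by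
      rintro ⟨b, x⟩ he
      simp only [mem_filter, mem_univ, true_and] at he
      obtain ⟨hbB, -, hx, hbx⟩ := he
      simp only [mem_union]
      by_cases h1 : p b = x
      · exact Or.inl (Or.inl (Or.inr (mem_image.2 ⟨b, hbB, by rw [h1]⟩)))
      by_cases h2 : p x = b
      · rcases hchild x hx b hbx h2 with h | h
        · refine Or.inl (Or.inr ?_)
          simp only [Y, mem_filter, mem_univ, true_and]
          exact ⟨hbB, h, fun e => hbx.ne (h2.symm.trans e), h2⟩
        · exact Or.inr (mem_image.2 ⟨x, h.1, by rw [h2]⟩)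
      · exact Or.inl (Or.inl (Or.inl (by simp [hXdef, hbx, h1, h2])))
    have h1 := card_le_card hsub
    have h2 := card_union_le (X ∪ (B.image fun v => (v, p v)) ∪ Y) (Q.image fun v => (p v, v))
    have h3 := card_union_le (X ∪ B.image fun v => (v, p v)) Y
    have h4 := card_union_le X (B.image fun v => (v, p v))
    have h5 : #(B.image fun v => (v, p v)) ≤ #B := card_image_le
    have h6 : #(Q.image fun v => (p v, v)) ≤ #Q := card_image_le
    omega
  let E' := E.filter fun e => e.1 ∉ B ∧ e.2 ∉ D₀
  have hfst : ∀ E'' ⊆ E, ∀ v, #(E''.filter fun e => e.1 = v) ≤ Δ := by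
    intro E'' hE'' v
    refine le_trans (card_le_card_of_injOn (t := G.neighborFinset v) Prod.snd ?_ ?_) (hΔ v)
    · intro e he
      obtain ⟨heE, rfl⟩ := mem_filter.1 he
      simpa using (hE e (hE'' heE)).2.2
    · intro e he f hf h
      exact Prod.ext ((mem_filter.1 he).2.trans (mem_filter.1 hf).2.symm) h
  have hsnd : ∀ E'' ⊆ E, ∀ v, #(E''.filter fun e => e.2 = v) ≤ Δ := by
    intro E'' hE'' v
    refine le_trans (card_le_card_of_injOn (t := G.neighborFinset v) Prod.fst ?_ ?_) (hΔ v)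
    · intro e he
      obtain ⟨heE, rfl⟩ := mem_filter.1 he
      simpa using (hE e (hE'' heE)).2.2.symm
    · intro e he f hf h
      exact Prod.ext h ((mem_filter.1 he).2.trans (mem_filter.1 hf).2.symm)
  have hEE' : #E ≤ #E' + Δ * (2 * #D₀ + 2 * ρ) := by
    have hsub : E ⊆ E' ∪ (B.biUnion fun v => E.filter fun e => e.1 = v) ∪
        D₀.biUnion fun v => E.filter fun e => e.2 = v := by
      intro e he
      simp only [E', mem_union, mem_filter, mem_biUnion, he, true_and]
      by_cases h1 : e.1 ∈ B
      · exact Or.inl (Or.inr ⟨_, h1, rfl⟩)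
      by_cases h2 : e.2 ∈ D₀
      · exact Or.inr ⟨_, h2, rfl⟩
      · exact Or.inl (Or.inl ⟨h1, h2⟩)
    have h1 := card_le_card hsub
    have h2 := card_union_le (E' ∪ (B.biUnion fun v => E.filter fun e => e.1 = v))
      (D₀.biUnion fun v => E.filter fun e => e.2 = v)
    have h3 := card_union_le E' (B.biUnion fun v => E.filter fun e => e.1 = v)
    have h4 : #(B.biUnion fun v => E.filter fun e => e.1 = v) ≤ #B * Δ :=
      card_biUnion_le_card_mul _ _ _ fun v _ => hfst E subset_rfl v
    have h5 : #(D₀.biUnion fun v => E.filter fun e => e.2 = v) ≤ #D₀ * Δ :=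
      card_biUnion_le_card_mul _ _ _ fun v _ => hsnd E subset_rfl v
    nlinarith
  obtain ⟨M, hME, hM1, hM2, hMc⟩ := exists_matching E' Δ (hfst E' (filter_subset _ _))
    (hsnd E' (filter_subset _ _))
  have hM : ∀ e ∈ M, e.1 ∈ L ∧ e.2 ∈ U ∧ e.2 ∉ D₀ ∧ G.Adj e.1 e.2 := by
    intro e he
    have h := mem_filter.1 (hME he)
    have h' := hE e h.1
    simp only [hBdef, mem_union, not_or] at h
    exact ⟨(hL _).2 ⟨h'.1, h.2.1.2, h.2.1.1⟩, h'.2.1, h.2.2, h'.2.2⟩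
  have hμ : ∀ l, ∃ u, l ∈ M.image Prod.fst → (l, u) ∈ M := by
    intro l
    by_cases h : l ∈ M.image Prod.fst
    · obtain ⟨e, he, rfl⟩ := mem_image.1 h
      exact ⟨e.2, fun _ => he⟩
    · exact ⟨l, fun h' => absurd h' h⟩
  choose μ hμ using hμ
  have hTU : ∀ x, p x ≠ x → T.Adj (p x) x := fun x hx => (hTp x hx).symm
  obtain ⟨x, hxU, h1, h2, h3⟩ := hlong
  have r1 := (hp _ h1).2
  have r2 := (hp _ h2).2
  have r3 := (hp _ h3).2
  obtain ⟨S, hS, hS', hcard⟩ := hT.exists_pairwise_not_iso hTG L p hg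
    (fun l hl => hDL _ (hgD l hl)) (M.image Prod.fst)
    (fun l hl => (hM _ (hμ l hl)).1) μ
    (fun l hl l' hl' e => congrArg Prod.fst (hM2 (hμ l hl) (hμ l' hl') e))
    (fun l hl => hUL _ (hM _ (hμ l hl)).2.1) (fun l hl => (hM _ (hμ l hl)).2.2.2)
    (fun l hl l' hl' e => (hM _ (hμ l hl)).2.2.1 (e ▸ hgD l' hl'))
    (fun l hl => by
      obtain ⟨w, hw, hwu, h | h⟩ := hnbr _ (hM _ (hμ l hl)).2.1
      · exact ⟨w, hUL w hw, h ▸ hTp _ (h ▸ hwu)⟩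
      · exact ⟨w, hUL w hw, (show p w = μ l from h) ▸ hTU w fun e => hwu (e.symm.trans h)⟩)
    (p (p x)) (p x) (hUL _ (hU _ (hU _ hxU))) (hUL _ (hU _ hxU)) (hTU _ h2)
    ⟨p (p (p x)), hUL _ (hU _ (hU _ (hU _ hxU))), fun e => by rw [e] at r3; omega, hTp _ h3⟩
    ⟨x, hUL _ hxU, fun e => by rw [← e] at r2; omega, hTU _ h1⟩
    B hB Δ _ hΔ hs
  rw [card_image_of_injOn hM1] at hcard
  exact ⟨#M, S, hS, hS', by omega, hcard⟩

/-- Most ordered pairs of adjacent vertices join two different paths of a maximal path family, or a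
path to its complement. -/
lemma SimpleGraph.card_adj_pairs_le_of_path_family (G : SimpleGraph V) {K m δ : ℕ}
    (hδ : ∀ v, δ ≤ G.degree v) (P : Fin m × Fin K → V)
    (hmK : m * K ≤ Fintype.card V) (hmax : ∀ q, ¬ G.IsPathIn (Set.range P)ᶜ K q)
    (b : V → Option (Fin m)) (hbP : ∀ x, b (P x) = some x.1)
    (hbn : ∀ v, v ∉ Set.range P → b v = none) :
    δ * Fintype.card V ≤ #(univ.filter fun e : V × V => G.Adj e.1 e.2 ∧ b e.1 ≠ b e.2) +
      3 * K * Fintype.card V := by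
  set n := Fintype.card V with hn
  let W : Finset V := univ.filter fun v => v ∉ Set.range P
  have hW : (W : Set V) = (Set.range P)ᶜ := by ext v; simp [W]
  have h1 := G.sum_degree_le_of_no_path K W (fun q => hW ▸ hmax q)
  let X : Finset (V × V) := univ.filter fun e => e.1 ∈ W ∧ e.2 ∈ W ∧ G.Adj e.1 e.2
  have hX : #X ≤ 2 * K * n := by
    have h2 : #X = ∑ v ∈ W, #(G.neighborFinset v ∩ W) := by
      have h3 : X = (W.sigma fun v => G.neighborFinset v ∩ W).image fun e => (e.1, e.2) := by
        ext ⟨x, y⟩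
        simp only [X, mem_filter, mem_univ, true_and, mem_image, mem_sigma, mem_inter,
          mem_neighborFinset, Prod.mk.injEq, Sigma.exists]
        constructor
        · rintro ⟨hx, hy, h⟩
          exact ⟨x, y, ⟨hx, h, hy⟩, rfl, rfl⟩
        · rintro ⟨x, y, ⟨hx, h, hy⟩, rfl, rfl⟩
          exact ⟨hx, hy, h⟩
      rw [h3, card_image_of_injective, card_sigma]
      rintro ⟨a, a'⟩ ⟨c, c'⟩ h
      simp only [Prod.mk.injEq] at h
      obtain ⟨rfl, rfl⟩ := h
      rfl
    rw [h2]
    exact h1.trans (Nat.mul_le_mul_left _ (card_le_univ W))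
  let Y : Finset (V × V) := univ.image fun t : (Fin m × Fin K) × Fin K => (P t.1, P (t.1.1, t.2))
  have hY : #Y ≤ K * n := by
    refine card_image_le.trans ?_
    simp only [card_univ, Fintype.card_prod, Fintype.card_fin]
    nlinarith
  have hsub : (univ.filter fun e : V × V => G.Adj e.1 e.2) ⊆
      (univ.filter fun e : V × V => G.Adj e.1 e.2 ∧ b e.1 ≠ b e.2) ∪ X ∪ Y := by
    rintro ⟨x, y⟩ h
    simp only [mem_filter, mem_univ, true_and] at h
    simp only [mem_union]
    by_cases hxy : b x = b y
    · by_cases hx : x ∈ Set.range P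
      · obtain ⟨t, rfl⟩ := hx
        by_cases hy : y ∈ Set.range P
        · obtain ⟨u, rfl⟩ := hy
          rw [hbP, hbP, Option.some.injEq] at hxy
          refine Or.inr (mem_image.2 ⟨(t, u.2), mem_univ _, ?_⟩)
          simp [hxy]
        · rw [hbP, hbn y hy] at hxy
          exact absurd hxy (by simp)
      · by_cases hy : y ∈ Set.range P
        · obtain ⟨u, rfl⟩ := hy
          rw [hbP, hbn x hx] at hxy
          exact absurd hxy (by simp)
        · exact Or.inl (Or.inr (mem_filter.2 ⟨mem_univ _, mem_filter.2 ⟨mem_univ _, hx⟩,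
            mem_filter.2 ⟨mem_univ _, hy⟩, h⟩))
    · exact Or.inl (Or.inl (mem_filter.2 ⟨mem_univ _, h, hxy⟩))
  have hdeg : #(univ.filter fun e : V × V => G.Adj e.1 e.2) = ∑ v, G.degree v := by
    rw [card_filter, Fintype.sum_prod_type]
    refine sum_congr rfl fun v _ => ?_
    rw [← card_filter, ← SimpleGraph.card_neighborFinset_eq_degree]
    congr 1
    ext w
    simp
  have h2 : δ * n ≤ ∑ v, G.degree v := by
    have := card_nsmul_le_sum univ (fun v => G.degree v) δ fun v _ => hδ v
    simpa [hn, mul_comm] using this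
  have h3 := card_le_card hsub
  have h4 := card_union_le ((univ.filter fun e : V × V => G.Adj e.1 e.2 ∧ b e.1 ≠ b e.2) ∪ X) Y
  have h5 := card_union_le (univ.filter fun e : V × V => G.Adj e.1 e.2 ∧ b e.1 ≠ b e.2) X
  rw [hdeg] at h3
  nlinarith

lemma SimpleGraph.Connected.exists_many_trees {G : SimpleGraph V} (hG : G.Connected)
    (K δ Δ : ℕ) (hK : 4 ≤ K) (hKδ : K * K ≤ 2 * δ) (hKδ' : 3 * K < δ) (hδ : ∀ v, δ ≤ G.degree v)
    (hΔ : ∀ v, G.degree v ≤ Δ) :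
    ∃ (N ρ : ℕ) (S : Finset (SimpleGraph V)), (∀ T ∈ S, T ≤ G ∧ T.IsTree) ∧
      (∀ T ∈ S, ∀ T' ∈ S, T ≠ T' → IsEmpty (T ≃g T')) ∧ K * ρ ≤ 4 * Fintype.card V ∧
      δ * Fintype.card V ≤ 3 * K * Fintype.card V + 4 * (2 * Δ * N + 4 * Δ * ρ) ∧
      2 ^ N ≤ Fintype.card V * (Fintype.card V * (Δ + 1) ^ (10 * ρ)) * #S := by
  have hne := hG.nonempty
  set n := Fintype.card V with hn
  have hn0 : 0 < n := Fintype.card_pos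
  obtain ⟨m, P, hP, hPA, hmK, hmax⟩ := G.exists_path_family K (by omega)
  obtain ⟨D₀, hD₀, hD₀c⟩ := G.exists_almost_dominating K (by omega)
    fun v => hKδ.trans (Nat.mul_le_mul_left _ (hδ v))
  have hb : ∀ v, ∃ o : Option (Fin m), (∀ x, P x = v → o = some x.1) ∧
      (v ∉ Set.range P → o = none) := by
    intro v
    by_cases hv : v ∈ Set.range P
    · obtain ⟨x, rfl⟩ := hv
      exact ⟨some x.1, fun y hy => by rw [hP hy], fun h => absurd ⟨x, rfl⟩ h⟩
    · exact ⟨none, fun x hx => absurd ⟨x, hx⟩ hv, fun _ => rfl⟩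
  choose b hb using hb
  have hbP : ∀ x, b (P x) = some x.1 := fun x => (hb _).1 x rfl
  have hbn : ∀ v, v ∉ Set.range P → b v = none := fun v => (hb v).2
  have hR := G.card_adj_pairs_le_of_path_family hδ P hmK hmax b hbP hbn
  set R := univ.filter fun e : V × V => G.Adj e.1 e.2 ∧ b e.1 ≠ b e.2 with hRdef
  have hRmem : ∀ e, e ∈ R ↔ G.Adj e.1 e.2 ∧ b e.1 ≠ b e.2 := by simp [hRdef]
  obtain ⟨χ, hχ, hcut⟩ := exists_cut b none R (fun e he => ((hRmem e).1 he).2)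
    fun e he => (hRmem _).2 ⟨((hRmem e).1 he).1.symm, ((hRmem e).1 he).2.symm⟩
  set E₀ := R.filter fun e => χ (b e.1) = true ∧ χ (b e.2) = false with hE₀
  let E : Finset (V × V) := E₀.image Prod.swap
  have hEc : #E = #E₀ := card_image_of_injective _ Prod.swap_injective
  let U : Finset V := univ.filter fun v => χ (b v) = true
  have hUmem : ∀ v, v ∈ U ↔ χ (b v) = true := by simp [U]
  have hUP : ∀ v ∈ U, ∃ x, P x = v := by
    intro v hv
    by_contra hc
    rw [hUmem, hbn v hc, hχ] at hv
    exact absurd hv (by simp)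
  have hPU : ∀ i j j', P (i, j) ∈ U → P (i, j') ∈ U := fun i j j' h => by
    rw [hUmem, hbP] at h ⊢
    exact h
  have hE : ∀ e ∈ E, e.1 ∉ U ∧ e.2 ∈ U ∧ G.Adj e.1 e.2 := by
    intro e he
    obtain ⟨f, hf, rfl⟩ := mem_image.1 he
    obtain ⟨hfR, h1, h2⟩ := mem_filter.1 hf
    exact ⟨by simp [hUmem, h2], (hUmem _).2 h1, ((hRmem f).1 hfR).1.symm⟩
  have hUne : ∃ u, u ∈ U := by
    have : 0 < #E₀ := by nlinarith
    obtain ⟨e, he⟩ := card_pos.1 this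
    exact ⟨e.1, (hUmem _).2 (mem_filter.1 he).2.1⟩
  have hp : ∀ v, ∃ y, (v ∈ U → ∀ x, P x = v → ((x.2 : ℕ) = 0 → y = v) ∧
      ∀ j : Fin K, (x.2 : ℕ) = j + 1 → y = P (x.1, j)) ∧ (v ∉ U → v ∈ D₀ → y = v) ∧
      (v ∉ U → v ∉ D₀ → y ∈ D₀ ∧ G.Adj v y) := by
    intro v
    by_cases hv : v ∈ U
    · obtain ⟨⟨i, j⟩, rfl⟩ := hUP v hv
      rcases Nat.eq_zero_or_pos (j : ℕ) with hj | hj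
      · refine ⟨P (i, j), fun _ x hx => ?_, by simp [hv], by simp [hv]⟩
        rw [hP hx]
        exact ⟨fun _ => rfl, fun j' hj' => by simp only at hj'; omega⟩
      · refine ⟨P (i, ⟨j - 1, by omega⟩), fun _ x hx => ?_, by simp [hv], by simp [hv]⟩
        rw [hP hx]
        refine ⟨fun h => by simp only at h; omega, fun j' hj' => ?_⟩
        simp only at hj'
        congr 3
        omega
    · by_cases hvD : v ∈ D₀
      · exact ⟨v, by simp [hv], fun _ _ => rfl, by simp [hvD]⟩
      · obtain ⟨u, hu⟩ := hD₀ v hvD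
        exact ⟨u, by simp [hv], by simp [hvD], fun _ _ => hu⟩
  choose p hpU hpD hpL using hp
  have hp0 : ∀ i (j : Fin K), P (i, j) ∈ U → (j : ℕ) = 0 → p (P (i, j)) = P (i, j) :=
    fun i j h hj => (hpU _ h _ rfl).1 hj
  have hp1 : ∀ i (j j' : Fin K), P (i, j) ∈ U → (j : ℕ) = j' + 1 → p (P (i, j)) = P (i, j') :=
    fun i j j' h hj => (hpU _ h _ rfl).2 j' hj
  have hr : ∀ v, ∃ t, (v ∈ U → ∀ x, P x = v → t = (x.2 : ℕ)) ∧ (v ∉ U → v ∈ D₀ → t = 0) ∧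
      (v ∉ U → v ∉ D₀ → t = K) := by
    intro v
    by_cases hv : v ∈ U
    · obtain ⟨x, rfl⟩ := hUP v hv
      exact ⟨x.2, fun _ y hy => by rw [hP hy], by simp [hv], by simp [hv]⟩
    · by_cases hvD : v ∈ D₀
      · exact ⟨0, by simp [hv], fun _ _ => rfl, by simp [hvD]⟩
      · exact ⟨K, by simp [hv], by simp [hvD], fun _ _ => rfl⟩
  choose r hrU hrD hrL using hr
  have hpred : ∀ v ∈ U, p v ≠ v → ∃ i, ∃ j j' : Fin K, (j : ℕ) = j' + 1 ∧ P (i, j) = v ∧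
      P (i, j') = p v := by
    intro v hv hpv
    obtain ⟨⟨i, j⟩, rfl⟩ := hUP v hv
    have hj : (j : ℕ) ≠ 0 := fun h => hpv (hp0 i j hv h)
    have hj' : (j : ℕ) = ((⟨j - 1, by omega⟩ : Fin K) : ℕ) + 1 := by simp only; omega
    exact ⟨i, j, _, hj', rfl, (hp1 i j _ hv hj').symm⟩
  have hpUU : ∀ v ∈ U, p v ∈ U := by
    intro v hv
    by_cases h : p v = v
    · rwa [h]
    · obtain ⟨i, j, j', -, h1, h2⟩ := hpred v hv h
      rw [← h2]
      exact hPU i j j' (h1 ▸ hv)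
  have hpr : ∀ v, p v ≠ v → G.Adj v (p v) ∧ r (p v) < r v := by
    intro v hpv
    by_cases hv : v ∈ U
    · obtain ⟨i, j, j', hj, h1, h2⟩ := hpred v hv hpv
      rw [hrU _ (hpUU v hv) _ h2, hrU v hv _ h1, ← h2, ← h1]
      exact ⟨(hPA i j' j hj).symm, by simp only; omega⟩
    · by_cases hvD : v ∈ D₀
      · exact absurd (hpD v hv hvD) hpv
      · obtain ⟨h1, h2⟩ := hpL v hv hvD
        refine ⟨h2, ?_⟩
        rw [hrL v hv hvD]
        by_cases h3 : p v ∈ U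
        · obtain ⟨x, hx⟩ := hUP _ h3
          rw [hrU _ h3 x hx]
          exact x.2.2
        · rw [hrD _ h3 h1]
          omega
  have hρ : #(univ.filter fun v => p v = v) ≤ m + #D₀ := by
    have hsub : (univ.filter fun v => p v = v) ⊆
        (univ.image fun i : Fin m => P (i, ⟨0, by omega⟩)) ∪ D₀ := by
      intro v hv
      have hv' := (mem_filter.1 hv).2
      rw [mem_union]
      by_cases hvU : v ∈ U
      · obtain ⟨⟨i, j⟩, rfl⟩ := hUP v hvU
        by_cases hj : (j : ℕ) = 0
        · refine Or.inl (mem_image.2 ⟨i, mem_univ _, ?_⟩)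
          congr 2
          exact Fin.ext hj.symm
        · have h := hp1 i j ⟨j - 1, by omega⟩ hvU (by simp only; omega)
          rw [hv'] at h
          have h' := congrArg Fin.val (Prod.mk.inj (hP h)).2
          simp only at h'
          omega
      · by_contra! hc
        have h := (hpL v hvU hc.2).2
        rw [hv'] at h
        exact G.loopless.irrefl _ h
    refine (card_le_card hsub).trans ((card_union_le _ _).trans (Nat.add_le_add_right ?_ _))
    exact card_image_le.trans (by simp)
  obtain ⟨N, S, hS, hS', hN, hcard⟩ := hG.exists_pairwise_not_iso_of_parent p r hpr U D₀ hpUU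
    (by
      intro v hv w hw hpv hpw h
      obtain ⟨i, j, j', hj, h1, h2⟩ := hpred v hv hpv
      obtain ⟨a, c, c', hc, h3, h4⟩ := hpred w hw hpw
      have h5 := hP (h2.trans (h.trans h4.symm))
      obtain ⟨rfl, rfl⟩ := Prod.mk.inj h5
      rw [← h1, ← h3]
      congr 2
      exact Fin.ext (hj.trans hc.symm))
    (by
      intro u hu
      obtain ⟨⟨i, j⟩, rfl⟩ := hUP u hu
      by_cases hj : (j : ℕ) = 0
      · have h1 : (⟨1, by omega⟩ : Fin K).val = j + 1 := by simp only; omega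
        refine ⟨P (i, ⟨1, by omega⟩), hPU _ _ _ hu, fun h => ?_,
          Or.inr (hp1 _ _ _ (hPU _ _ _ hu) h1)⟩
        rw [(Prod.mk.inj (hP h)).2] at h1
        omega
      · have h1 : (j : ℕ) = (⟨j - 1, by omega⟩ : Fin K).val + 1 := by simp only; omega
        refine ⟨P (i, ⟨j - 1, by omega⟩), hPU _ _ _ hu, fun h => ?_, Or.inl (hp1 _ _ _ hu h1)⟩
        rw [(Prod.mk.inj (hP h)).2] at h1
        omega)
    (fun v hv hvU => hpD v hvU hv) (fun v hvU hv => (hpL v hvU hv).1)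
    (by
      obtain ⟨u, hu⟩ := hUne
      obtain ⟨⟨i, j⟩, rfl⟩ := hUP u hu
      have h : ∀ j, P (i, j) ∈ U := fun j' => hPU _ _ _ hu
      have hne : ∀ a c : Fin K, (a : ℕ) ≠ c → P (i, a) ≠ P (i, c) := fun a c hac e =>
        hac (congrArg Fin.val (Prod.mk.inj (hP e)).2)
      have e3 := hp1 i ⟨3, by omega⟩ ⟨2, by omega⟩ (h _) rfl
      have e2 := hp1 i ⟨2, by omega⟩ ⟨1, by omega⟩ (h _) rfl
      have e1 := hp1 i ⟨1, by omega⟩ ⟨0, by omega⟩ (h _) rfl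
      refine ⟨P (i, ⟨3, by omega⟩), h _, ?_⟩
      rw [e3, e2, e1]
      exact ⟨hne _ _ (by simp), hne _ _ (by simp), hne _ _ (by simp)⟩)
    E hE Δ (m + #D₀) hΔ hρ
  refine ⟨N, m + #D₀, S, hS, hS', by nlinarith, ?_, hcard.trans ?_⟩
  · have h1 : Δ * (2 * #D₀ + 2 * (m + #D₀)) ≤ 4 * Δ * (m + #D₀) := by nlinarith
    rw [hEc] at hN
    rw [← hn] at hR
    omega
  · gcongr
    · omega
    · omega

lemma eventually_log_natCast_le {ε r : ℝ} (hε : 0 < ε) (hr : 0 < r) :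
    ∀ᶠ n : ℕ in Filter.atTop, Real.log n ≤ ε * (n : ℝ) ^ r := by
  have h := (isLittleO_log_rpow_atTop hr).bound hε
  filter_upwards [tendsto_natCast_atTop_atTop.eventually h] with n hn
  exact (le_abs_self _).trans (hn.trans_eq (by rw [Real.norm_of_nonneg (by positivity)]))

lemma exists_forall_exp_le :
    ∃ d₀ : ℕ, ∀ d ≥ d₀, 8 ≤ d.sqrt ∧ ∀ n N ρ s : ℕ, d ≤ 2 * n → d.sqrt * ρ ≤ 4 * n →
      d * n ≤ 2 * (3 * d.sqrt * n + 4 * (2 * (2 * d) * N + 4 * (2 * d) * ρ)) →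
      2 ^ N ≤ n * (n * (2 * d + 1) ^ (10 * ρ)) * s → Real.exp (1 / 256 * n) ≤ s := by
  obtain ⟨d₁, h₁⟩ := Filter.eventually_atTop.1
    (eventually_log_natCast_le (ε := 1 / 100000) (r := 1 / 2) (by norm_num) (by norm_num))
  obtain ⟨d₂, h₂⟩ := Filter.eventually_atTop.1
    (eventually_log_natCast_le (ε := 1 / 1024) (r := 1) (by norm_num) (by norm_num))
  refine ⟨max (max d₁ (2 * d₂)) (2000 * 2000), fun d hd => ?_⟩
  simp only [ge_iff_le, max_le_iff] at hd
  obtain ⟨⟨hd₁, hd₂⟩, hd₃⟩ := hd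
  have hK : 2000 ≤ d.sqrt := Nat.le_sqrt.2 hd₃
  refine ⟨by omega, fun n N ρ s hdn hρ hN hs => ?_⟩
  have hlogd := h₁ d hd₁
  have hlogn := h₂ n (by omega)
  rw [← Real.sqrt_eq_rpow] at hlogd
  rw [Real.rpow_one] at hlogn
  set q := Real.sqrt d with hq
  have hqq : q * q = d := Real.mul_self_sqrt (Nat.cast_nonneg d)
  have hq0 : 0 ≤ q := Real.sqrt_nonneg _
  have hKq : (d.sqrt : ℝ) ≤ q := Real.nat_sqrt_le_real_sqrt
  have hqK : q ≤ d.sqrt + 1 := Real.real_sqrt_le_nat_sqrt_succ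
  have hK' : (2000 : ℝ) ≤ d.sqrt := by exact_mod_cast hK
  have hn0 : (0 : ℝ) < n := by
    have : 0 < n := by omega
    exact_mod_cast this
  have hρ' : (d.sqrt : ℝ) * ρ ≤ 4 * n := by exact_mod_cast hρ
  have hN' : (d : ℝ) * n ≤ 2 * (3 * (d.sqrt : ℝ) * n + 4 * (2 * (2 * d) * N + 4 * (2 * d) * ρ)) := by
    exact_mod_cast hN
  set k : ℝ := (d.sqrt : ℝ)
  have hρq : q * ρ ≤ 8 * n := by
    have : (0 : ℝ) ≤ ρ := Nat.cast_nonneg ρ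
    nlinarith
  have hNn : (n : ℝ) / 64 ≤ N := by
    rw [← hqq] at hN'
    have h1 : 3 * k * n ≤ 3 * q * n := by gcongr
    have h2 : q * (q * n) ≤ q * (6 * n + 32 * q * N + 512 * n) := by
      nlinarith
    have h3 : q * n ≤ 6 * n + 32 * q * N + 512 * n :=
      le_of_mul_le_mul_left h2 (by linarith)
    have h4 : q * (n / 64) ≤ q * N := by nlinarith
    exact le_of_mul_le_mul_left h4 (by linarith)
  have hs0 : 0 < s := by
    rcases Nat.eq_zero_or_pos s with rfl | h
    · simp at hs
    · exact h
  have hs' : ((2 : ℝ) ^ N) ≤ n * (n * (2 * d + 1) ^ (10 * ρ)) * s := by exact_mod_cast hs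
  have hd : (2000 * 2000 : ℝ) ≤ d := by exact_mod_cast hd₃
  have hd0 : (0 : ℝ) < d := by linarith
  have hlog := Real.log_le_log (by positivity) hs'
  rw [Real.log_mul (by positivity) (by positivity), Real.log_mul (by positivity) (by positivity),
    Real.log_mul (by positivity) (by positivity), Real.log_pow, Real.log_pow] at hlog
  have hlog2d : Real.log (2 * d + 1) ≤ 2 * Real.log d := by
    rw [← Real.log_rpow hd0]
    apply Real.log_le_log (by positivity)
    rw [Real.rpow_two]
    nlinarith
  have hρlog : ((10 * ρ : ℕ) : ℝ) * Real.log (2 * d + 1) ≤ n / 512 := by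
    push_cast
    have h1 : 10 * (ρ : ℝ) * Real.log (2 * d + 1) ≤ 10 * ρ * (2 * (1 / 100000 * q)) := by
      gcongr
      linarith
    nlinarith
  have hlog2 : (N : ℝ) * (1 / 2) ≤ N * Real.log 2 := by
    gcongr
    linarith [Real.log_two_gt_d9]
  rw [← Real.le_log_iff_exp_le (by exact_mod_cast hs0)]
  linarith

lemma SimpleGraph.Connected.exists_pairwise_not_iso_of_sqrt {G : SimpleGraph V}
    (hG : G.Connected) {d : ℕ} (hd : 8 ≤ d.sqrt)
    (hlow : ∀ v, d ≤ 2 * G.degree v) (hup : ∀ v, G.degree v ≤ 2 * d) :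
    ∃ (N ρ : ℕ) (S : Finset (SimpleGraph V)), (∀ T ∈ S, T ≤ G ∧ T.IsTree) ∧
      (∀ T ∈ S, ∀ T' ∈ S, T ≠ T' → IsEmpty (T ≃g T')) ∧ d ≤ 2 * Fintype.card V ∧
      d.sqrt * ρ ≤ 4 * Fintype.card V ∧
      d * Fintype.card V ≤ 2 * (3 * d.sqrt * Fintype.card V +
        4 * (2 * (2 * d) * N + 4 * (2 * d) * ρ)) ∧
      2 ^ N ≤ Fintype.card V * (Fintype.card V * (2 * d + 1) ^ (10 * ρ)) * #S := by
  have hKK := Nat.sqrt_le d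
  obtain ⟨N, ρ, S, hS, hS', hρ, hN, hcard⟩ := hG.exists_many_trees d.sqrt ((d + 1) / 2) (2 * d)
    (by omega) (by omega) (by have := Nat.mul_le_mul_right d.sqrt hd; omega)
    (fun v => by have := hlow v; omega) hup
  obtain ⟨v⟩ := hG.nonempty
  have hdV := (hlow v).trans (Nat.mul_le_mul_left 2 (G.degree_lt_card_verts v).le)
  refine ⟨N, ρ, S, hS, hS', hdV, hρ, ?_, hcard⟩
  have h := Nat.mul_le_mul_right (Fintype.card V) (show d ≤ 2 * ((d + 1) / 2) by omega)
  rw [mul_assoc 2] at h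
  omega

end SpanningTreeCount

/-- **Lee's theorem.** There exist constants `δ > 0`, `c > 0` and `d₀` such that for all
`d ≥ d₀`, if `G` is a connected graph with `n` vertices all of whose degrees lie in the
interval `[(1-δ)d, (1+δ)d]`, then the number of pairwise non-isomorphic spanning trees
of `G` is at least `e^{c·n}`. -/
theorem lee_nonisomorphic_spanning_trees :
    ∃ (δ c : ℝ) (d₀ : ℕ), 0 < δ ∧ 0 < c ∧
      ∀ (d : ℕ), d₀ ≤ d →
      ∀ (V : Type) [Fintype V] [DecidableEq V] (G : SimpleGraph V) [DecidableRel G.Adj],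
        G.Connected →
        (∀ v : V, (1 - δ) * d ≤ (G.degree v : ℝ) ∧ (G.degree v : ℝ) ≤ (1 + δ) * d) →
        ∃ S : Finset (SimpleGraph V),
          (∀ T ∈ S, T ≤ G ∧ T.IsTree) ∧
          (∀ T ∈ S, ∀ T' ∈ S, T ≠ T' → IsEmpty (T ≃g T')) ∧
          Real.exp (c * (Fintype.card V : ℝ)) ≤ (S.card : ℝ) := by
  obtain ⟨d₀, h⟩ := exists_forall_exp_le
  refine ⟨1 / 2, 1 / 256, d₀, by norm_num, by norm_num, fun d hd V _ _ G _ hG hdeg => ?_⟩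
  obtain ⟨hK, hexp⟩ := h d hd
  obtain ⟨N, ρ, S, hS, hS', hn, hρ, hN, hcard⟩ := hG.exists_pairwise_not_iso_of_sqrt hK
    (fun v => by
      have h' : (d : ℝ) ≤ (2 * G.degree v : ℕ) := by push_cast; linarith [(hdeg v).1]
      convert Nat.cast_le.1 h')
    (fun v => by
      have h' : (G.degree v : ℝ) ≤ (2 * d : ℕ) := by
        push_cast
        linarith [(hdeg v).2, Nat.cast_nonneg (α := ℝ) d]
      convert Nat.cast_le.1 h')
  exact ⟨S, hS, hS', hexp _ N ρ _ hn hρ hN hcard⟩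
end
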